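/- arXiv:2311.08017 — 2 statements merged into one kernel-verified Lean document; each statement's English description precedes it below -/
import Mathlib

section
/- Let Ω ⊊ ℝ² be a nonempty open simply connected set. Then for every u ∈ C_c^∞(Ω), ∫_Ω ‖∇u‖² dx ≥ (1/16) ∫_Ω u²/d² dx. -/
open MeasureTheory Real

section

open Filter Metric Set Topology

/-- A square root of a nonvanishing holomorphic function is holomorphic. -/
theorem exists_differentiableOn_sq_eq {U : Set ℂ} (hUo : IsOpen U) (hUc : IsSimplyConnected U)
    {k : ℂ → ℂ} (hk : DifferentiableOn ℂ k U) (h0 : ∀ z ∈ U, k z ≠ 0) :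
    ∃ φ : ℂ → ℂ, (∀ z, φ z ^ 2 = k z) ∧ ∀ z ∈ U, HasDerivAt φ (deriv k z / (2 * φ z)) z := by
  obtain ⟨φ, hφc, hφ⟩ := Complex.exists_continuousOn_pow_eq hUc hUo hk.continuousOn
    (by rintro ⟨z, hz, hz0⟩; exact h0 z hz hz0) two_ne_zero
  refine ⟨φ, hφ, fun z hz => ?_⟩
  have hφz : φ z ≠ 0 := fun h => h0 z hz (by rw [← hφ z, h]; simp)
  have hc : ContinuousAt φ z := hφc.continuousAt (hUo.mem_nhds hz)
  have hkd : HasDerivAt k (deriv k z) z :=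
    (hk.differentiableAt (hUo.mem_nhds hz)).hasDerivAt
  rw [hasDerivAt_iff_tendsto_slope] at hkd ⊢
  have hsum : Tendsto (fun w => φ w + φ z) (𝓝[≠] z) (𝓝 (2 * φ z)) := by
    rw [two_mul]
    exact (hc.tendsto.mono_left nhdsWithin_le_nhds).add tendsto_const_nhds
  have hne : (2 * φ z) ≠ 0 := mul_ne_zero two_ne_zero hφz
  refine (hkd.div hsum hne).congr' ?_
  filter_upwards [hsum.eventually_ne hne] with w hw
  simp only [Pi.div_apply]
  rw [slope_def_field, slope_def_field, ← hφ w, ← hφ z]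
  field_simp
  ring

/-- A form of **Hurwitz's theorem**: values of a locally uniform limit which is not locally
constant are attained nearby. -/
theorem TendstoLocallyUniformlyOn.eventually_exists_eq {ι : Type*} {l : Filter ι} {U : Set ℂ}
    {F : ι → ℂ → ℂ} {f : ℂ → ℂ} (hF : TendstoLocallyUniformlyOn F f l U)
    (hUo : IsOpen U) [l.NeBot] (hd : ∀ n, DifferentiableOn ℂ (F n) U) {p : ℂ} (hp : p ∈ U)
    (hf : ¬ ∀ᶠ z in 𝓝 p, f z = f p) {c : ι → ℂ} (hc : Tendsto c l (𝓝 (f p)))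
    {V : Set ℂ} (hV : V ∈ 𝓝 p) : ∀ᶠ n in l, ∃ z ∈ V ∩ U, F n z = c n := by
  have hfd : DifferentiableOn ℂ f U := hF.differentiableOn (.of_forall hd) hUo
  have hfa : AnalyticAt ℂ f p := hfd.analyticAt (hUo.mem_nhds hp)
  have hne := (hfa.eventually_eq_or_eventually_ne analyticAt_const).resolve_left hf
  have hev : ∀ᶠ z in 𝓝 p, (z ≠ p → f z ≠ f p) ∧ z ∈ V ∩ U := by
    refine (eventually_nhdsWithin_iff.mp hne).and (inter_mem hV (hUo.mem_nhds hp))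
  obtain ⟨r, hr, hrs⟩ := nhds_basis_closedBall.eventually_iff.mp hev
  have hsub : closedBall p r ⊆ U := fun z hz => (hrs hz).2.2
  have hcomp : IsCompact (sphere p r) := isCompact_sphere p r
  have hcont : ContinuousOn (fun z => ‖f z - f p‖) (sphere p r) :=
    ((hfd.continuousOn.mono (sphere_subset_closedBall.trans hsub)).sub continuousOn_const).norm
  obtain ⟨x, hx, hxm⟩ := hcomp.exists_isMinOn (NormedSpace.sphere_nonempty.mpr hr.le) hcont
  set ε := ‖f x - f p‖ with hε
  have hε0 : 0 < ε := by
    rw [hε, norm_pos_iff, sub_ne_zero]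
    exact (hrs (sphere_subset_closedBall hx)).1 (ne_of_mem_sphere hx hr.ne')
  have hu : TendstoUniformlyOn F f l (closedBall p r) :=
    (tendstoLocallyUniformlyOn_iff_forall_isCompact hUo).mp hF _ hsub (isCompact_closedBall p r)
  have hpp : Tendsto (fun n => F n p) l (𝓝 (f p)) := hF.tendsto_at hp
  filter_upwards [Metric.tendstoUniformlyOn_iff.mp hu (ε / 8) (by positivity),
    Metric.tendsto_nhds.mp hc (ε / 8) (by positivity)] with n hn hcn
  have hpn := hn p (mem_closedBall_self hr.le)
  have hlow : ∀ z ∈ sphere p r, ε / 2 ≤ ‖F n z - F n p‖ := by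
    intro z hz
    have h1 : ε ≤ ‖f z - f p‖ := hxm hz
    have h2 := hn z (sphere_subset_closedBall hz)
    rw [dist_eq_norm] at h2 hpn
    have h3 : ‖f z - f p‖ ≤ ‖f z - F n z‖ + ‖F n z - F n p‖ + ‖f p - F n p‖ := by
      have : f z - f p = (f z - F n z) + (F n z - F n p) - (f p - F n p) := by ring
      rw [this]
      exact (norm_sub_le _ _).trans (add_le_add_left (norm_add_le _ _) _)
    linarith
  have hdc : DiffContOnCl ℂ (F n) (ball p r) := by
    refine DifferentiableOn.diffContOnCl ?_
    rw [closure_ball p hr.ne']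
    exact (hd n).mono hsub
  have hfreq : ∃ᶠ z in 𝓝 p, F n z ≠ F n p := by
    intro hcon
    simp only [not_not] at hcon
    have han : AnalyticOnNhd ℂ (F n) (closedBall p r) := fun z hz =>
      (hd n).analyticAt (hUo.mem_nhds (hsub hz))
    have := han.eqOn_of_preconnected_of_eventuallyEq (g := fun _ => F n p)
      analyticOnNhd_const (convex_closedBall p r).isPreconnected (mem_closedBall_self hr.le) hcon
    have h4 := hlow x hx
    rw [this (sphere_subset_closedBall hx)] at h4
    simp at h4
    linarith
  have := hdc.ball_subset_image_closedBall hr hlow hfreq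
  obtain ⟨z, hz, hzc⟩ := this (show c n ∈ ball (F n p) (ε / 2 / 2) by
    rw [mem_ball]
    have := dist_triangle (c n) (f p) (F n p)
    linarith)
  exact ⟨z, (hrs hz).2, hzc⟩

/-- Uniformly bounded, pointwise convergent families of holomorphic functions converge locally
uniformly. -/
theorem tendstoLocallyUniformlyOn_of_norm_le_one {ι : Type*} {l : Filter ι} {U : Set ℂ}
    {F : ι → ℂ → ℂ} {f : ℂ → ℂ} (hUo : IsOpen U) [l.NeBot]
    (hd : ∀ n, DifferentiableOn ℂ (F n) U) (hb : ∀ n, ∀ z ∈ U, ‖F n z‖ ≤ 1)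
    (hp : ∀ z ∈ U, Tendsto (fun n => F n z) l (𝓝 (f z))) :
    TendstoLocallyUniformlyOn F f l U := by
  rw [Metric.tendstoLocallyUniformlyOn_iff]
  intro ε hε x hx
  obtain ⟨R, hR, hRU⟩ := Metric.isOpen_iff.mp hUo x hx
  have hlip : ∀ n, ∀ z ∈ ball x R, dist (F n z) (F n x) ≤ 2 / R * dist z x := by
    intro n z hz
    refine Complex.dist_le_div_mul_dist_of_mapsTo_ball ((hd n).mono hRU) (fun w hw => ?_) hz
    rw [mem_closedBall, dist_eq_norm]
    refine (norm_sub_le _ _).trans ?_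
    linarith [hb n w (hRU hw), hb n x hx]
  have hlipf : ∀ z ∈ ball x R, dist (f z) (f x) ≤ 2 / R * dist z x := fun z hz =>
    le_of_tendsto ((hp z (hRU hz)).dist (hp x hx)) (.of_forall fun n => hlip n z hz)
  set δ := min R (R * ε / 8)
  have hδ : 0 < δ := by positivity
  refine ⟨ball x δ, mem_nhdsWithin_of_mem_nhds (ball_mem_nhds x hδ), ?_⟩
  filter_upwards [Metric.tendsto_nhds.mp (hp x hx) (ε / 4) (by positivity)] with n hn y hy
  have hyR : y ∈ ball x R := ball_subset_ball (min_le_left _ _) hy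
  have h1 := hlip n y hyR
  have h2 := hlipf y hyR
  have h3 : 2 / R * dist y x ≤ ε / 4 := by
    have : dist y x ≤ R * ε / 8 := (mem_ball.mp hy).le.trans (min_le_right _ _)
    calc 2 / R * dist y x ≤ 2 / R * (R * ε / 8) := by gcongr
      _ = ε / 4 := by field_simp; norm_num
  have h4 := dist_triangle4 (f y) (f x) (F n x) (F n y)
  rw [dist_comm (f x), dist_comm (F n x) (F n y)] at h4
  linarith

/-- The Möbius automorphism of the unit disk sending `w` to `0`. -/
noncomputable def diskMobius (w z : ℂ) : ℂ := (z - w) / (1 - (starRingEnd ℂ) w * z)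

theorem diskMobius_denom_ne_zero {w z : ℂ} (hw : ‖w‖ < 1) (hz : ‖z‖ < 1) :
    1 - (starRingEnd ℂ) w * z ≠ 0 := by
  intro h
  have h1 : ‖(starRingEnd ℂ) w * z‖ = 1 := by rw [← sub_eq_zero.mp h, norm_one]
  rw [norm_mul, RCLike.norm_conj] at h1
  nlinarith [norm_nonneg w, norm_nonneg z]

theorem norm_one_sub_conj_mul_sq (w z : ℂ) :
    ‖1 - (starRingEnd ℂ) w * z‖ ^ 2 - ‖z - w‖ ^ 2 = (1 - ‖w‖ ^ 2) * (1 - ‖z‖ ^ 2) := by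
  simp only [Complex.sq_norm, Complex.normSq_apply, Complex.sub_re, Complex.sub_im, Complex.mul_re,
    Complex.mul_im, Complex.conj_re, Complex.conj_im, Complex.one_re, Complex.one_im]
  ring

theorem norm_diskMobius_lt_one {w z : ℂ} (hw : ‖w‖ < 1) (hz : ‖z‖ < 1) :
    ‖diskMobius w z‖ < 1 := by
  have h0 := norm_pos_iff.mpr (diskMobius_denom_ne_zero hw hz)
  rw [diskMobius, norm_div, div_lt_one h0]
  have h1 := norm_one_sub_conj_mul_sq w z
  have h2 : 0 < (1 - ‖w‖ ^ 2) * (1 - ‖z‖ ^ 2) :=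
    mul_pos (by nlinarith [norm_nonneg w]) (by nlinarith [norm_nonneg z])
  exact lt_of_pow_lt_pow_left₀ 2 h0.le (by linarith)

theorem diskMobius_self (w : ℂ) : diskMobius w w = 0 := by simp [diskMobius]

theorem diskMobius_zero (w : ℂ) : diskMobius w 0 = -w := by simp [diskMobius]

theorem diskMobius_eq_zero_iff {w z : ℂ} (hw : ‖w‖ < 1) (hz : ‖z‖ < 1) :
    diskMobius w z = 0 ↔ z = w := by
  rw [diskMobius, div_eq_zero_iff, or_iff_left (diskMobius_denom_ne_zero hw hz), sub_eq_zero]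

theorem diskMobius_neg_diskMobius {w z : ℂ} (hw : ‖w‖ < 1) (hz : ‖z‖ < 1) :
    diskMobius (-w) (diskMobius w z) = z := by
  have h1 := diskMobius_denom_ne_zero hw hz
  have h2 := diskMobius_denom_ne_zero (w := -w) (by rwa [norm_neg]) (norm_diskMobius_lt_one hw hz)
  have h3 := diskMobius_denom_ne_zero hw hw
  rw [diskMobius, div_eq_iff h2]
  simp only [diskMobius, map_neg, sub_neg_eq_add]
  rw [div_add' _ _ _ h1, div_eq_iff h1]
  linear_combination -(z * (starRingEnd ℂ) w) * (div_mul_cancel₀ (z - w) h1)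

theorem diskMobius_injOn {w : ℂ} (hw : ‖w‖ < 1) : InjOn (diskMobius w) (ball 0 1) := by
  intro a ha b hb hab
  rw [← diskMobius_neg_diskMobius hw (mem_ball_zero_iff.mp ha), hab,
    diskMobius_neg_diskMobius hw (mem_ball_zero_iff.mp hb)]

theorem hasDerivAt_diskMobius {w z : ℂ} (hw : ‖w‖ < 1) (hz : ‖z‖ < 1) :
    HasDerivAt (diskMobius w) ((1 - (‖w‖ : ℂ) ^ 2) / (1 - (starRingEnd ℂ) w * z) ^ 2) z := by
  have h1 := diskMobius_denom_ne_zero hw hz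
  have h := ((hasDerivAt_id z).sub_const w).div
    (((hasDerivAt_id z).const_mul ((starRingEnd ℂ) w)).const_sub 1) h1
  refine h.congr_deriv ?_
  congr 1
  rw [← Complex.conj_mul']
  simp only [id]
  ring

theorem one_sub_norm_sq_ne_zero {w : ℂ} (hw : ‖w‖ < 1) : (1 - (‖w‖ : ℂ) ^ 2) ≠ 0 := by
  have : (1 - ‖w‖ ^ 2 : ℝ) ≠ 0 := by nlinarith [norm_nonneg w]
  exact_mod_cast this

/-- Injective holomorphic maps into the unit disk with nonvanishing derivative, sending `z₀`
to `0`. -/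
structure IsDiskEmbedding (U : Set ℂ) (z₀ : ℂ) (f : ℂ → ℂ) : Prop where
  mapsTo : MapsTo f U (ball 0 1)
  injOn : InjOn f U
  deriv_ne_zero : ∀ z ∈ U, deriv f z ≠ 0
  map_base : f z₀ = 0

theorem IsDiskEmbedding.hasDerivAt {U : Set ℂ} {z₀ : ℂ} {f : ℂ → ℂ} (h : IsDiskEmbedding U z₀ f)
    {z : ℂ} (hz : z ∈ U) : HasDerivAt f (deriv f z) z :=
  (differentiableAt_of_deriv_ne_zero (h.deriv_ne_zero z hz)).hasDerivAt

theorem IsDiskEmbedding.differentiableOn {U : Set ℂ} {z₀ : ℂ} {f : ℂ → ℂ}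
    (h : IsDiskEmbedding U z₀ f) : DifferentiableOn ℂ f U :=
  fun _ hz => (h.hasDerivAt hz).differentiableAt.differentiableWithinAt

theorem exists_isDiskEmbedding {U : Set ℂ} (hUo : IsOpen U) (hUc : IsSimplyConnected U)
    (hU : U ≠ univ) {z₀ : ℂ} (hz₀ : z₀ ∈ U) : ∃ f, IsDiskEmbedding U z₀ f := by
  obtain ⟨a, ha⟩ := (ne_univ_iff_exists_notMem U).mp hU
  have hne : ∀ z ∈ U, z - a ≠ 0 := fun z hz h => ha (sub_eq_zero.mp h ▸ hz)
  obtain ⟨φ, hφ, hφd⟩ := exists_differentiableOn_sq_eq hUo hUc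
    (k := fun z => z - a) (by fun_prop) hne
  have hφ0 : ∀ z ∈ U, φ z ≠ 0 := fun z hz h => hne z hz (by rw [← hφ z, h]; simp)
  have hφd' : ∀ z ∈ U, HasDerivAt φ (2 * φ z)⁻¹ z := fun z hz =>
    (hφd z hz).congr_deriv (by simp)
  have hinj : ∀ z w, φ z ^ 2 = φ w ^ 2 → z = w := fun z w h => by
    simpa [hφ] using h
  have han : AnalyticAt ℂ φ z₀ :=
    DifferentiableOn.analyticAt (s := U)
      (fun z hz => (hφd' z hz).differentiableAt.differentiableWithinAt) (hUo.mem_nhds hz₀)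
  have hopen : 𝓝 (φ z₀) ≤ map φ (𝓝 z₀) := by
    refine han.eventually_constant_or_nhds_le_map_nhds.resolve_left fun hc => ?_
    have h1 := (hφd' z₀ hz₀).unique
      ((hasDerivAt_const z₀ (φ z₀)).congr_of_eventuallyEq hc)
    exact hφ0 z₀ hz₀ (by simpa using h1)
  obtain ⟨ε, hε, hball⟩ := Metric.mem_nhds_iff.mp (hopen (image_mem_map (hUo.mem_nhds hz₀)))
  have hfar : ∀ z ∈ U, ε ≤ ‖φ z + φ z₀‖ := by
    intro z hz
    by_contra! hlt
    obtain ⟨w, hw, hwz⟩ := hball (show -φ z ∈ ball (φ z₀) ε by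
      rw [mem_ball, dist_eq_norm, ← norm_neg]; simpa [add_comm] using hlt)
    have hzw : z = w := hinj _ _ (by rw [hwz]; ring)
    subst hzw
    have : (2 : ℂ) * φ z = 0 := by linear_combination hwz
    exact hφ0 z hz (by simpa using this)
  have hden : ∀ z ∈ U, φ z + φ z₀ ≠ 0 := fun z hz h => by
    have := hfar z hz
    rw [h, norm_zero] at this
    linarith
  have hε' : (ε : ℂ) ≠ 0 := by exact_mod_cast hε.ne'
  have hdf : ∀ z ∈ U, HasDerivAt
      (fun z => (ε / 3 : ℂ) * ((φ z + φ z₀)⁻¹ - (φ z₀ + φ z₀)⁻¹))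
      ((ε / 3 : ℂ) * (-(2 * φ z)⁻¹ / (φ z + φ z₀) ^ 2)) z := fun z hz =>
    ((((hφd' z hz).add_const _).fun_inv (hden z hz)).sub_const _).const_mul _
  have hn : ∀ z ∈ U, ‖(φ z + φ z₀)⁻¹‖ ≤ ε⁻¹ := fun z hz => by
    rw [norm_inv]; exact inv_anti₀ hε (hfar z hz)
  refine ⟨fun z => (ε / 3 : ℂ) * ((φ z + φ z₀)⁻¹ - (φ z₀ + φ z₀)⁻¹), ?_, ?_, fun z hz => ?_, ?_⟩
  · intro z hz
    rw [mem_ball_zero_iff, norm_mul]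
    have h1 : ‖(ε / 3 : ℂ)‖ = ε / 3 := by simp [abs_of_pos hε]
    have h2 := (norm_sub_le (φ z + φ z₀)⁻¹ (φ z₀ + φ z₀)⁻¹).trans
      (add_le_add (hn z hz) (hn z₀ hz₀))
    rw [h1]
    calc ε / 3 * _ ≤ ε / 3 * (ε⁻¹ + ε⁻¹) := by gcongr
      _ = 2 / 3 := by field_simp; norm_num
      _ < 1 := by norm_num
  · intro z hz w hw h
    have h2 := mul_left_cancel₀ (div_ne_zero hε' three_ne_zero) h
    have h3 : φ z = φ w := by simpa using h2
    exact hinj z w (by rw [h3])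
  · rw [(hdf z hz).deriv]
    exact mul_ne_zero (div_ne_zero hε' three_ne_zero) (div_ne_zero
      (neg_ne_zero.mpr (inv_ne_zero (mul_ne_zero two_ne_zero (hφ0 z hz))))
      (pow_ne_zero 2 (hden z hz)))
  · simp

theorem IsDiskEmbedding.exists_lt_of_notMem {U : Set ℂ} (hUo : IsOpen U)
    (hUc : IsSimplyConnected U) {z₀ : ℂ} (hz₀ : z₀ ∈ U) {f : ℂ → ℂ} (hf : IsDiskEmbedding U z₀ f)
    {w : ℂ} (hw : ‖w‖ < 1) (hwf : w ∉ f '' U) :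
    ∃ g, IsDiskEmbedding U z₀ g ∧ ‖deriv f z₀‖ < ‖deriv g z₀‖ := by
  have hf1 : ∀ z ∈ U, ‖f z‖ < 1 := fun z hz => mem_ball_zero_iff.mp (hf.mapsTo hz)
  have hw0 : w ≠ 0 := fun h => hwf ⟨z₀, hz₀, by rw [hf.map_base, h]⟩
  have hkd : ∀ z ∈ U, HasDerivAt (fun z => diskMobius w (f z)) _ z := fun z hz =>
    (hasDerivAt_diskMobius hw (hf1 z hz)).comp z (hf.hasDerivAt hz)
  have hk0 : ∀ z ∈ U, diskMobius w (f z) ≠ 0 := fun z hz h =>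
    hwf ⟨z, hz, (diskMobius_eq_zero_iff hw (hf1 z hz)).mp h⟩
  obtain ⟨φ, hφ, hφd⟩ := exists_differentiableOn_sq_eq hUo hUc
    (fun z hz => (hkd z hz).differentiableAt.differentiableWithinAt) hk0
  have hφ0 : ∀ z ∈ U, φ z ≠ 0 := fun z hz h => hk0 z hz (by rw [← hφ z, h]; simp)
  have hφ1 : ∀ z ∈ U, ‖φ z‖ < 1 := fun z hz => by
    have := norm_diskMobius_lt_one hw (hf1 z hz)
    rw [← hφ z, norm_pow] at this
    exact (pow_lt_one_iff_of_nonneg (norm_nonneg _) two_ne_zero).mp this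
  have hgd : ∀ z ∈ U, HasDerivAt (fun z => diskMobius (φ z₀) (φ z)) _ z := fun z hz =>
    (hasDerivAt_diskMobius (hφ1 z₀ hz₀) (hφ1 z hz)).comp z (hφd z hz)
  refine ⟨fun z => diskMobius (φ z₀) (φ z), ⟨?_, ?_, ?_, diskMobius_self _⟩, ?_⟩
  · intro z hz
    exact mem_ball_zero_iff.mpr (norm_diskMobius_lt_one (hφ1 z₀ hz₀) (hφ1 z hz))
  · intro a ha b hb hab
    have h1 := diskMobius_injOn (hφ1 z₀ hz₀) (mem_ball_zero_iff.mpr (hφ1 a ha))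
      (mem_ball_zero_iff.mpr (hφ1 b hb)) hab
    refine hf.injOn ha hb (diskMobius_injOn hw (hf.mapsTo ha) (hf.mapsTo hb) ?_)
    rw [← hφ a, ← hφ b, h1]
  · intro z hz
    rw [(hgd z hz).deriv, (hkd z hz).deriv]
    exact mul_ne_zero (div_ne_zero (one_sub_norm_sq_ne_zero (hφ1 z₀ hz₀))
      (pow_ne_zero 2 (diskMobius_denom_ne_zero (hφ1 z₀ hz₀) (hφ1 z hz))))
      (div_ne_zero (mul_ne_zero (div_ne_zero (one_sub_norm_sq_ne_zero hw)
        (pow_ne_zero 2 (diskMobius_denom_ne_zero hw (hf1 z hz)))) (hf.deriv_ne_zero z hz))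
        (mul_ne_zero two_ne_zero (hφ0 z hz)))
  · rw [(hgd z₀ hz₀).deriv, (hkd z₀ hz₀).deriv]
    set t := ‖φ z₀‖ with ht
    have ht1 : t < 1 := hφ1 z₀ hz₀
    have ht0 : 0 < t := norm_pos_iff.mpr (hφ0 z₀ hz₀)
    have htw : ‖w‖ = t ^ 2 := by
      rw [ht, ← norm_pow, hφ, hf.map_base, diskMobius_zero, norm_neg]
    have hD : 0 < ‖deriv f z₀‖ := norm_pos_iff.mpr (hf.deriv_ne_zero z₀ hz₀)
    have h1 : 0 < 1 - t ^ 2 := by nlinarith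
    have hr : ∀ x : ℝ, 0 ≤ 1 - x ^ 2 → ‖(1 - (x : ℂ) ^ 2)‖ = 1 - x ^ 2 := fun x hx => by
      have : (1 - (x : ℂ) ^ 2) = ((1 - x ^ 2 : ℝ) : ℂ) := by push_cast; ring
      rw [this, Complex.norm_real, Real.norm_of_nonneg hx]
    have hc : 1 - (starRingEnd ℂ) (φ z₀) * φ z₀ = 1 - (t : ℂ) ^ 2 := by
      rw [Complex.conj_mul']
    rw [hf.map_base, hc, mul_zero, sub_zero, one_pow, div_one, norm_mul, norm_div, norm_div,
      norm_mul, norm_pow, norm_mul, hr t h1.le, htw, hr (t ^ 2) (by nlinarith [sq_nonneg t]), ← ht]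
    rw [show ‖(2 : ℂ)‖ = 2 by simp]
    have : (1 - t ^ 2) / (1 - t ^ 2) ^ 2 * ((1 - (t ^ 2) ^ 2) * ‖deriv f z₀‖ / (2 * t))
        = ‖deriv f z₀‖ * ((1 + t ^ 2) / (2 * t)) := by
      field_simp
      ring
    rw [this]
    refine lt_mul_of_one_lt_right hD ?_
    rw [one_lt_div (by positivity)]
    nlinarith [mul_pos (sub_pos.mpr ht1) (sub_pos.mpr ht1)]

/-- The **Riemann mapping theorem**. -/
theorem exists_riemann_map {U : Set ℂ} (hUo : IsOpen U) (hUc : IsSimplyConnected U)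
    (hU : U ≠ univ) :
    ∃ f : ℂ → ℂ, f '' U = ball 0 1 ∧ InjOn f U ∧ ∀ z ∈ U, deriv f z ≠ 0 := by
  obtain ⟨z₀, hz₀⟩ := hUc.nonempty
  have hconn : IsPreconnected U := hUc.isPathConnected.isConnected.isPreconnected
  obtain ⟨f₀, hf₀⟩ := exists_isDiskEmbedding hUo hUc hU hz₀
  set S : Set ℝ := (fun f : ℂ → ℂ => ‖deriv f z₀‖) '' {f | IsDiskEmbedding U z₀ f} with hS
  obtain ⟨R, hR, hRU⟩ := Metric.isOpen_iff.mp hUo z₀ hz₀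
  have hSb : BddAbove S := by
    refine ⟨1 / R, ?_⟩
    rintro _ ⟨f, hf, rfl⟩
    refine Complex.norm_deriv_le_div_of_mapsTo_ball (hf.differentiableOn.mono hRU) ?_ hR
    rw [hf.map_base]
    exact fun z hz => ball_subset_closedBall (hf.mapsTo (hRU hz))
  have hSne : S.Nonempty := ⟨_, f₀, hf₀, rfl⟩
  have hM : 0 < sSup S := (norm_pos_iff.mpr (hf₀.deriv_ne_zero z₀ hz₀)).trans_le
    (le_csSup hSb ⟨f₀, hf₀, rfl⟩)
  obtain ⟨v, -, hvt, hvS⟩ := exists_seq_tendsto_sSup hSne hSb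
  choose F hF hFv using hvS
  replace hF : ∀ n, IsDiskEmbedding U z₀ (F n) := hF
  let l : Ultrafilter ℕ := hyperfilter ℕ
  have hl : (l : Filter ℕ) ≤ atTop := Nat.hyperfilter_le_atTop
  have hb : ∀ n, ∀ z ∈ U, ‖F n z‖ ≤ 1 := fun n z hz =>
    (mem_ball_zero_iff.mp ((hF n).mapsTo hz)).le
  have hlim : ∀ z, ∃ y : ℂ, z ∈ U → ‖y‖ ≤ 1 ∧ Tendsto (fun n => F n z) l (𝓝 y) := by
    intro z
    by_cases hz : z ∈ U
    · obtain ⟨y, hy, hyl⟩ := (isCompact_closedBall (0 : ℂ) 1).ultrafilter_le_nhds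
        (l.map fun n => F n z) (by
          rw [le_principal_iff]
          exact Filter.mem_map.mpr (Filter.Eventually.of_forall fun n =>
            mem_closedBall_zero_iff.mpr (hb n z hz)))
      exact ⟨y, fun _ => ⟨mem_closedBall_zero_iff.mp hy, hyl⟩⟩
    · exact ⟨0, fun h => absurd h hz⟩
  choose f hf using hlim
  have hd : ∀ n, DifferentiableOn ℂ (F n) U := fun n => (hF n).differentiableOn
  have hT : TendstoLocallyUniformlyOn F f l U :=
    tendstoLocallyUniformlyOn_of_norm_le_one hUo hd hb fun z hz => (hf z hz).2
  have hT' := hT.deriv (.of_forall hd) hUo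
  have hfd : DifferentiableOn ℂ f U := hT.differentiableOn (.of_forall hd) hUo
  have hfa : AnalyticOnNhd ℂ f U := hfd.analyticOnNhd hUo
  have hDM : ‖deriv f z₀‖ = sSup S :=
    tendsto_nhds_unique (hT'.tendsto_at hz₀).norm
      ((hvt.mono_left hl).congr fun n => (hFv n).symm)
  have hD0 : deriv f z₀ ≠ 0 := norm_pos_iff.mp (hDM ▸ hM)
  have hnc : ∀ p ∈ U, ¬ ∀ᶠ z in 𝓝 p, f z = f p := by
    intro p hp hc
    have h1 : EqOn f (fun _ => f p) U :=
      hfa.eqOn_of_preconnected_of_eventuallyEq analyticOnNhd_const hconn hp hc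
    refine hD0 ?_
    rw [(h1.eventuallyEq_of_mem (hUo.mem_nhds hz₀)).deriv_eq, deriv_const]
  have hinj : InjOn f U := by
    intro a ha b hbU hab
    by_contra hne
    have := hT.eventually_exists_eq hUo hd ha (hnc a ha)
      (c := fun n => F n b) (hab ▸ (hf b hbU).2) (isOpen_ne.mem_nhds hne : {z | z ≠ b} ∈ 𝓝 a)
    obtain ⟨n, z, ⟨hzb, hzU⟩, hz⟩ := this.exists
    exact hzb ((hF n).injOn hzU hbU hz)
  have hder : ∀ z ∈ U, deriv f z ≠ 0 := by
    intro p hp hp0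
    have hnc' : ¬ ∀ᶠ z in 𝓝 p, deriv f z = deriv f p := by
      intro hc
      have h1 : EqOn (deriv f) (fun _ => deriv f p) U :=
        hfa.deriv.eqOn_of_preconnected_of_eventuallyEq analyticOnNhd_const hconn hp hc
      exact hD0 ((h1 hz₀).trans hp0)
    have := hT'.eventually_exists_eq hUo (fun n => (hd n).deriv hUo) hp hnc'
      (c := fun _ => 0) (by rw [hp0]; exact tendsto_const_nhds) univ_mem
    obtain ⟨n, z, ⟨-, hzU⟩, hz⟩ := this.exists
    exact (hF n).deriv_ne_zero z hzU hz
  have hmaps : f '' U ⊆ ball 0 1 := by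
    have hopen : IsOpen (f '' U) := by
      refine (hfa.is_constant_or_isOpen hconn).resolve_left ?_ U subset_rfl hUo
      rintro ⟨w, hw⟩
      exact hnc z₀ hz₀ (by
        filter_upwards [hUo.mem_nhds hz₀] with z hz
        rw [hw z hz, hw z₀ hz₀])
    rw [← interior_closedBall (0 : ℂ) one_ne_zero]
    refine interior_maximal ?_ hopen
    rintro _ ⟨z, hz, rfl⟩
    exact mem_closedBall_zero_iff.mpr (hf z hz).1
  have hf0 : f z₀ = 0 := tendsto_nhds_unique (hf z₀ hz₀).2
    (tendsto_const_nhds.congr fun n => (hF n).map_base.symm)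
  have hemb : IsDiskEmbedding U z₀ f := ⟨image_subset_iff.mp hmaps, hinj, hder, hf0⟩
  refine ⟨f, hmaps.antisymm fun w hw => ?_, hinj, hder⟩
  by_contra hwf
  obtain ⟨g, hg, hlt⟩ := hemb.exists_lt_of_notMem hUo hUc hz₀ (mem_ball_zero_iff.mp hw) hwf
  exact (le_csSup hSb ⟨g, hg, rfl⟩).not_gt (hDM ▸ hlt)

theorem Complex.det_smul_one_clm (c : ℂ) :
    (c • (1 : ℂ →L[ℝ] ℂ)).det = ‖c‖ ^ 2 := by
  have h : ((c • (1 : ℂ →L[ℝ] ℂ) : ℂ →L[ℝ] ℂ) : ℂ →ₗ[ℝ] ℂ) = LinearMap.mulLeft ℝ c := by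
    ext; simp
  rw [ContinuousLinearMap.det, h, ← Complex.normSq_eq_norm_sq, ← Algebra.norm_complex_apply]
  rfl

theorem lintegral_eq_lintegral_polar {Φ : ℂ → ENNReal} (hΦ : Measurable Φ) :
    ∫⁻ z, Φ z = ∫⁻ ρ in Ioi (0 : ℝ), ∫⁻ θ in Ioo (-π) π,
      ENNReal.ofReal ρ * Φ (circleMap 0 ρ θ) := by
  rw [← Complex.lintegral_comp_polarCoord_symm, polarCoord_target, Measure.volume_eq_prod,
    ← Measure.prod_restrict, lintegral_prod]
  · simp [Complex.polarCoord_symm_apply, circleMap, Complex.exp_mul_I]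
  · simp only [Complex.polarCoord_symm_apply]
    fun_prop

theorem lintegral_Ioo_inv {a b : ℝ} (ha : 0 < a) (hab : a < b) :
    ∫⁻ ρ in Ioo a b, ENNReal.ofReal ρ⁻¹ = ENNReal.ofReal (log (b / a)) := by
  have hi : IntervalIntegrable (fun x : ℝ => x⁻¹) volume a b :=
    intervalIntegral.intervalIntegrable_inv (fun x hx => by
      rw [uIcc_of_le hab.le] at hx; exact (ha.trans_le hx.1).ne') continuousOn_id
  rw [← integral_inv_of_pos ha (ha.trans hab), intervalIntegral.integral_of_le hab.le,
    integral_Ioc_eq_integral_Ioo, ofReal_integral_eq_lintegral_ofReal]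
  · exact ((intervalIntegrable_iff_integrableOn_Ioc_of_le hab.le).mp hi).mono_set Ioo_subset_Ioc_self
  · filter_upwards [ae_restrict_mem measurableSet_Ioo] with x hx
    exact inv_nonneg.mpr (ha.trans hx.1).le

/-- The open annulus of radii `a` and `b`. -/
def openAnnulus (a b : ℝ) : Set ℂ := {z | a < ‖z‖ ∧ ‖z‖ < b}

theorem isOpen_openAnnulus (a b : ℝ) : IsOpen (openAnnulus a b) :=
  (isOpen_lt continuous_const continuous_norm).inter (isOpen_lt continuous_norm continuous_const)

theorem circleMap_mem_openAnnulus_iff {a b ρ θ : ℝ} (hρ : 0 < ρ) :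
    circleMap 0 ρ θ ∈ openAnnulus a b ↔ ρ ∈ Ioo a b := by
  simp [openAnnulus, abs_of_pos hρ]

theorem lintegral_openAnnulus_eq {a b : ℝ} (ha : 0 < a) {Φ : ℂ → ENNReal}
    (hΦ : Measurable ((openAnnulus a b).indicator Φ)) :
    ∫⁻ z in openAnnulus a b, Φ z = ∫⁻ ρ in Ioo a b, ∫⁻ θ in Ioo (-π) π,
      ENNReal.ofReal ρ * Φ (circleMap 0 ρ θ) := by
  rw [← lintegral_indicator (isOpen_openAnnulus a b).measurableSet, lintegral_eq_lintegral_polar hΦ]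
  have hsub : Ioo a b ⊆ Ioi 0 := fun x hx => ha.trans hx.1
  rw [← inter_eq_self_of_subset_left hsub, ← setLIntegral_indicator measurableSet_Ioo]
  refine setLIntegral_congr_fun measurableSet_Ioi fun ρ hρ => ?_
  by_cases h : ρ ∈ Ioo a b
  · rw [indicator_of_mem h]
    simp only [indicator_of_mem ((circleMap_mem_openAnnulus_iff hρ).mpr h)]
  · rw [indicator_of_notMem h]
    have := fun θ => mt (circleMap_mem_openAnnulus_iff (θ := θ) hρ).mp h
    simp [this]

theorem lintegral_openAnnulus_norm {a b : ℝ} (ha : 0 < a) (hab : a < b) :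
    ∫⁻ z in openAnnulus a b, ENNReal.ofReal (‖z‖ ^ 2)⁻¹ =
      ENNReal.ofReal (log (b / a)) * ENNReal.ofReal (2 * π) := by
  rw [lintegral_openAnnulus_eq ha ((Measurable.indicator (by fun_prop))
    (isOpen_openAnnulus a b).measurableSet), ← lintegral_Ioo_inv ha hab,
    ← lintegral_mul_const _ (by fun_prop)]
  refine setLIntegral_congr_fun measurableSet_Ioo fun ρ hρ => ?_
  have h0 : 0 < ρ := ha.trans hρ.1
  simp only [norm_circleMap_zero, sq_abs, lintegral_const, Measure.restrict_apply MeasurableSet.univ,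
    univ_inter, Real.volume_Ioo]
  rw [← ENNReal.ofReal_mul h0.le]
  congr 2
  · field_simp
  · ring

/-- Jensen's inequality for the square, on an interval of length `2 * π`. -/
theorem ofReal_two_pi_le_lintegral_norm_sq {q : ℝ → ℂ} (hq : Continuous q)
    (havg : ∫ θ in Ioo (-π) π, q θ = 2 * π) :
    ENNReal.ofReal (2 * π) ≤ ∫⁻ θ in Ioo (-π) π, ENNReal.ofReal (‖q θ‖ ^ 2) := by
  have hint : ∀ {E : Type} [NormedAddCommGroup E] {f : ℝ → E}, Continuous f →
      IntegrableOn f (Ioo (-π) π) := fun hf =>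
    (hf.integrableOn_Icc).mono_set Ioo_subset_Icc_self
  have hqr : Continuous fun θ => (q θ).re := Complex.continuous_re.comp hq
  have hqn : Continuous fun θ => ‖q θ‖ ^ 2 := hq.norm.pow 2
  have h2r : Continuous fun θ => 2 * (q θ).re := continuous_const.mul hqr
  have h2s : Continuous fun θ => 2 * (q θ).re - 1 := h2r.sub continuous_const
  have hge : 2 * π ≤ ∫ θ in Ioo (-π) π, ‖q θ‖ ^ 2 := by
    have h1 : ∫ θ in Ioo (-π) π, (2 * (q θ).re - 1) = 2 * π := by
      have hre : ∫ θ in Ioo (-π) π, (q θ).re = 2 * π := by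
        have := integral_re (𝕜 := ℂ) (hint hq)
        simp only [RCLike.re_to_complex] at this
        rw [this, havg]
        simp
      rw [integral_sub (hint h2r) (hint continuous_const),
        integral_const_mul, hre]
      simp [pi_pos.le]
      ring
    rw [← h1]
    refine integral_mono (hint h2s) (hint hqn)
      fun θ => ?_
    simp only
    rw [Complex.sq_norm, Complex.normSq_apply]
    nlinarith [sq_nonneg ((q θ).re - 1), sq_nonneg (q θ).im]
  refine (ENNReal.ofReal_le_ofReal hge).trans_eq ?_
  exact ofReal_integral_eq_lintegral_ofReal (hint hqn) (.of_forall fun θ => by positivity)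

theorem lintegral_openAnnulus_logDeriv_ge {G : ℂ → ℂ} (hG : DifferentiableOn ℂ G (ball 0 1))
    (hinj : InjOn G (ball 0 1)) (hG0 : G 0 = 0) (hd : deriv G 0 ≠ 0) {a b : ℝ} (ha : 0 < a)
    (hab : a < b) (hb : b < 1) :
    ENNReal.ofReal (log (b / a)) * ENNReal.ofReal (2 * π) ≤
      ∫⁻ z in openAnnulus a b, ENNReal.ofReal (‖deriv G z / G z‖ ^ 2) := by
  have hsub : openAnnulus a b ⊆ ball 0 1 := fun z hz => mem_ball_zero_iff.mpr (hz.2.trans hb)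
  have h0 : ∀ z ∈ ball (0 : ℂ) 1, z ≠ 0 → G z ≠ 0 := fun z hz hz0 h =>
    hz0 (hinj hz (mem_ball_self one_pos) (h.trans hG0.symm))
  have hdd : DifferentiableOn ℂ (deriv G) (ball 0 1) := hG.deriv isOpen_ball
  have hmeas : Measurable ((openAnnulus a b).indicator
      fun z => ENNReal.ofReal (‖deriv G z / G z‖ ^ 2)) := by
    classical
    rw [← piecewise_eq_indicator]
    refine ContinuousOn.measurable_piecewise ?_ continuousOn_const
      (isOpen_openAnnulus a b).measurableSet
    refine ENNReal.continuous_ofReal.comp_continuousOn (ContinuousOn.pow (ContinuousOn.norm ?_) 2)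
    exact (hdd.continuousOn.mono hsub).div (hG.continuousOn.mono hsub) fun z hz =>
      h0 z (hsub hz) (norm_pos_iff.mp (ha.trans hz.1))
  rw [lintegral_openAnnulus_eq ha hmeas, ← lintegral_Ioo_inv ha hab,
    ← lintegral_mul_const _ (by fun_prop)]
  refine setLIntegral_mono' measurableSet_Ioo fun ρ hρ => ?_
  have hρ0 : 0 < ρ := ha.trans hρ.1
  have hρ1 : ρ < 1 := hρ.2.trans hb
  set Q : ℂ → ℂ := fun z => deriv G z / dslope G 0 z with hQ
  have hslope : ∀ z, z ≠ 0 → dslope G 0 z = G z / z := fun z hz => by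
    rw [dslope_of_ne _ hz, slope_def_field, hG0, sub_zero, sub_zero]
  have hQd : DifferentiableOn ℂ Q (ball 0 1) := by
    refine hdd.div ((Complex.differentiableOn_dslope (ball_mem_nhds 0 one_pos)).mpr hG) ?_
    intro z hz
    by_cases hz0 : z = 0
    · rwa [hz0, dslope_same]
    · rw [hslope z hz0]
      exact div_ne_zero (h0 z hz hz0) hz0
  have hcirc : ∀ θ, circleMap 0 ρ θ ∈ ball (0 : ℂ) 1 := fun θ => by
    simpa [abs_of_pos hρ0] using hρ1
  have hQn : ∀ θ, ‖deriv G (circleMap 0 ρ θ) / G (circleMap 0 ρ θ)‖ ^ 2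
      = (ρ ^ 2)⁻¹ * ‖Q (circleMap 0 ρ θ)‖ ^ 2 := by
    intro θ
    have hne : circleMap 0 ρ θ ≠ 0 := circleMap_ne_center hρ0.ne'
    simp only [hQ, hslope _ hne, norm_div, norm_circleMap_zero, abs_of_pos hρ0]
    field_simp
  have havg : ∫ θ in Ioo (-π) π, Q (circleMap 0 ρ θ) = 2 * π := by
    have h1 : circleAverage Q 0 ρ = Q 0 := by
      refine DiffContOnCl.circleAverage (DifferentiableOn.diffContOnCl ?_)
      rw [abs_of_pos hρ0, closure_ball _ hρ0.ne']
      exact hQd.mono (closedBall_subset_ball hρ1)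
    rw [circleAverage_eq_integral_add (-π), intervalIntegral.integral_comp_add_right
      (fun θ => Q (circleMap 0 ρ θ)), zero_add, show 2 * π + -π = π by ring,
      intervalIntegral.integral_of_le (by linarith [pi_pos]), integral_Ioc_eq_integral_Ioo] at h1
    have h2 : Q 0 = 1 := by simp [hQ, dslope_same, hd]
    rw [h2, Complex.real_smul] at h1
    have h3 : (π : ℂ) ≠ 0 := by exact_mod_cast pi_ne_zero
    push_cast at h1
    field_simp at h1
    rw [h1]
  have hcont : Continuous fun θ => Q (circleMap 0 ρ θ) :=
    hQd.continuousOn.comp_continuous (continuous_circleMap 0 ρ) hcirc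
  simp only [hQn]
  have : ∀ θ, ENNReal.ofReal ρ * ENNReal.ofReal ((ρ ^ 2)⁻¹ * ‖Q (circleMap 0 ρ θ)‖ ^ 2)
      = ENNReal.ofReal ρ⁻¹ * ENNReal.ofReal (‖Q (circleMap 0 ρ θ)‖ ^ 2) := fun θ => by
    rw [← ENNReal.ofReal_mul hρ0.le, ← ENNReal.ofReal_mul (by positivity)]
    congr 1
    field_simp
  simp only [this]
  rw [lintegral_const_mul' _ _ ENNReal.ofReal_ne_top]
  gcongr
  exact ofReal_two_pi_le_lintegral_norm_sq hcont havg

theorem lintegral_image_inv_norm_sq {f f' : ℂ → ℂ} {s : Set ℂ} (hs : MeasurableSet s)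
    (hf : ∀ z ∈ s, HasDerivAt f (f' z) z) (hinj : InjOn f s) :
    ∫⁻ w in f '' s, ENNReal.ofReal (‖w‖ ^ 2)⁻¹ =
      ∫⁻ z in s, ENNReal.ofReal (‖f' z / f z‖ ^ 2) := by
  rw [lintegral_image_eq_lintegral_abs_det_fderiv_mul volume hs
    (fun z hz => (hf z hz).complexToReal_fderiv.hasFDerivWithinAt) hinj]
  refine setLIntegral_congr_fun hs fun z _ => ?_
  rw [Complex.det_smul_one_clm, ← ENNReal.ofReal_mul (abs_nonneg _), abs_of_nonneg (by positivity),
    norm_div, div_pow, div_eq_mul_inv]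

/-- A function vanishing at `0` with derivative of norm greater than `q` there maps thin annuli
around `0` to annuli whose inner radius is `q` times larger. -/
theorem exists_mapsTo_openAnnulus {G : ℂ → ℂ} (hG : DifferentiableOn ℂ G (ball 0 1))
    (hinj : InjOn G (ball 0 1)) (hG0 : G 0 = 0) {q r : ℝ} (hq : 0 < q) (hqG : q < ‖deriv G 0‖)
    (hr : 0 < r) (hr1 : r < 1) :
    ∃ ε, 0 < ε ∧ ε < r ∧ q * ε < 1 ∧
      MapsTo G (openAnnulus ε r) (openAnnulus (q * ε) (q * ε)⁻¹) := by
  have hsub : closedBall (0 : ℂ) r ⊆ ball 0 1 := closedBall_subset_ball hr1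
  have hk : ContinuousOn (dslope G 0) (ball 0 1) :=
    ((Complex.differentiableOn_dslope (ball_mem_nhds 0 one_pos)).mpr hG).continuousOn
  have hslope : ∀ z, G z = z * dslope G 0 z := fun z => by
    have := sub_smul_dslope G 0 z
    simpa [hG0] using this.symm
  have hk0 : ∀ z ∈ ball (0 : ℂ) 1, dslope G 0 z ≠ 0 := fun z hz h => by
    have h1 : G z = 0 := by rw [hslope, h, mul_zero]
    have h2 : z = 0 := hinj hz (mem_ball_self one_pos) (h1.trans hG0.symm)
    rw [h2, dslope_same] at h
    rw [h, norm_zero] at hqG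
    exact hqG.not_gt hq
  have hnear : ∀ᶠ z in 𝓝 (0 : ℂ), q < ‖dslope G 0 z‖ := by
    refine ((hk.continuousAt (ball_mem_nhds 0 one_pos)).norm).eventually (lt_mem_nhds ?_)
    simpa only [dslope_same] using hqG
  obtain ⟨δ, hδ, hδq⟩ := Metric.eventually_nhds_iff_ball.mp hnear
  have hne : (closedBall (0 : ℂ) r).Nonempty := ⟨0, mem_closedBall_self hr.le⟩
  obtain ⟨z₀, hz₀, hmin⟩ := (isCompact_closedBall (0 : ℂ) r).exists_isMinOn hne
    (hk.mono hsub).norm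
  obtain ⟨z₁, -, hmax⟩ := (isCompact_closedBall (0 : ℂ) r).exists_isMaxOn hne
    (hG.continuousOn.mono hsub).norm
  have hκ : 0 < ‖dslope G 0 z₀‖ := norm_pos_iff.mpr (hk0 z₀ (hsub hz₀))
  set κ := ‖dslope G 0 z₀‖
  set M := ‖G z₁‖
  have hM : 0 < M + 1 := by positivity
  obtain ⟨ε, hε, hlt⟩ := exists_between (show 0 < min (min r (κ * δ / q)) (min q⁻¹ (q * (M + 1))⁻¹)
    by positivity)
  simp only [lt_min_iff] at hlt
  obtain ⟨⟨hεr, hεκ⟩, hεq, hεM⟩ := hlt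
  rw [lt_div_iff₀ hq] at hεκ
  refine ⟨ε, hε, hεr, ?_, fun z hz => ⟨?_, ?_⟩⟩
  · rw [lt_inv_comm₀ hε hq, lt_inv_comm₀ hq hε] at hεq
    calc q * ε < q * q⁻¹ := by gcongr
      _ = 1 := mul_inv_cancel₀ hq.ne'
  · have hz0 : 0 < ‖z‖ := hε.trans hz.1
    rw [hslope, norm_mul]
    rcases lt_or_ge ‖z‖ δ with h | h
    · have h1 := hδq z (mem_ball_zero_iff.mpr h)
      calc q * ε < q * ‖z‖ := by gcongr; exact hz.1
        _ ≤ ‖z‖ * ‖dslope G 0 z‖ := by rw [mul_comm]; gcongr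
    · have h1 : κ ≤ ‖dslope G 0 z‖ := hmin (mem_closedBall_zero_iff.mpr hz.2.le)
      calc q * ε = ε * q := mul_comm _ _
        _ < κ * δ := hεκ
        _ ≤ ‖z‖ * ‖dslope G 0 z‖ := by rw [mul_comm]; gcongr
  · have h1 : ‖G z‖ ≤ M := hmax (mem_closedBall_zero_iff.mpr hz.2.le)
    refine h1.trans_lt ((lt_add_one M).trans ?_)
    rw [← one_div, lt_div_iff₀ (by positivity)] at hεM ⊢
    linarith

/-- The **Bieberbach–Eilenberg inequality** for injective functions. -/
theorem norm_deriv_le_one_of_mul_ne_one {G : ℂ → ℂ} (hG : DifferentiableOn ℂ G (ball 0 1))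
    (hinj : InjOn G (ball 0 1)) (hG0 : G 0 = 0)
    (hmul : ∀ z ∈ ball (0 : ℂ) 1, ∀ w ∈ ball (0 : ℂ) 1, G z * G w ≠ 1) :
    ‖deriv G 0‖ ≤ 1 := by
  by_contra! hgt
  have hd : deriv G 0 ≠ 0 := fun h => by simp [h] at hgt; linarith
  obtain ⟨q, hq1, hqG⟩ := exists_between hgt
  obtain ⟨r, hqr, hr1⟩ := exists_between (inv_lt_one_of_one_lt₀ hq1)
  have hq : 0 < q := one_pos.trans hq1
  have hr : 0 < r := (inv_pos.mpr hq).trans hqr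
  obtain ⟨ε, hε, hεr, hqε, hmaps⟩ := exists_mapsTo_openAnnulus hG hinj hG0 hq hqG hr hr1
  set A := openAnnulus ε r with hA
  set m := q * ε with hm_def
  have hm : 0 < m := mul_pos hq hε
  have hAo : MeasurableSet A := (isOpen_openAnnulus ε r).measurableSet
  have hsub : A ⊆ ball 0 1 := fun z hz => mem_ball_zero_iff.mpr (hz.2.trans hr1)
  have hGne : ∀ z ∈ A, G z ≠ 0 := fun z hz => norm_pos_iff.mp (hm.trans (hmaps hz).1)
  have hder : ∀ z ∈ A, HasDerivAt G (deriv G z) z := fun z hz =>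
    (hG.differentiableAt (isOpen_ball.mem_nhds (hsub hz))).hasDerivAt
  have hder' : ∀ z ∈ A, HasDerivAt (fun z => (G z)⁻¹) (-deriv G z / G z ^ 2) z := fun z hz =>
    (hder z hz).inv (hGne z hz)
  have hinjA : InjOn G A := hinj.mono hsub
  have hinjA' : InjOn (fun z => (G z)⁻¹) A := fun z hz w hw h => hinjA hz hw (inv_injective h)
  have hlow := lintegral_openAnnulus_logDeriv_ge hG hinj hG0 hd hε hεr hr1
  have h1 := lintegral_image_inv_norm_sq hAo hder hinjA
  have h2 := lintegral_image_inv_norm_sq hAo hder' hinjA'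
  have h3 : ∫⁻ z in A, ENNReal.ofReal (‖-deriv G z / G z ^ 2 / (G z)⁻¹‖ ^ 2)
      = ∫⁻ z in A, ENNReal.ofReal (‖deriv G z / G z‖ ^ 2) := by
    refine setLIntegral_congr_fun hAo fun z hz => ?_
    have := hGne z hz
    have h4 : -deriv G z / G z ^ 2 / (G z)⁻¹ = -(deriv G z / G z) := by field_simp
    simp only [h4, norm_neg]
  have hdisj : Disjoint (G '' A) ((fun z => (G z)⁻¹) '' A) := by
    rw [Set.disjoint_left]
    rintro _ ⟨z, hz, rfl⟩ ⟨w, hw, h⟩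
    refine hmul z (hsub hz) w (hsub hw) ?_
    rw [← show (G w)⁻¹ = G z from h, inv_mul_cancel₀ (hGne w hw)]
  have hmeas : MeasurableSet ((fun z => (G z)⁻¹) '' A) :=
    measurable_image_of_fderivWithin hAo
      (fun z hz => (hder' z hz).complexToReal_fderiv.hasFDerivWithinAt) hinjA'
  have hunion : G '' A ∪ (fun z => (G z)⁻¹) '' A ⊆ openAnnulus m m⁻¹ := by
    refine union_subset hmaps.image_subset ?_
    rintro _ ⟨z, hz, rfl⟩
    have hp := hm.trans (hmaps hz).1
    simp only [openAnnulus, mem_ofPred_eq, norm_inv]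
    exact ⟨(lt_inv_comm₀ hp hm).mp (hmaps hz).2, inv_strictAnti₀ hm (hmaps hz).1⟩
  have hup := lintegral_mono_set (μ := volume) (f := fun w : ℂ => ENNReal.ofReal (‖w‖ ^ 2)⁻¹) hunion
  have hm1 : m < m⁻¹ := hqε.trans (one_lt_inv₀ hm |>.mpr hqε)
  rw [lintegral_union hmeas hdisj, h1, h2, h3, lintegral_openAnnulus_norm hm hm1] at hup
  have hfin := (add_le_add hlow hlow).trans hup
  have hl1 : 0 ≤ log (r / ε) := log_nonneg ((one_le_div hε).mpr hεr.le)
  rw [← ENNReal.ofReal_mul hl1, ← ENNReal.ofReal_mul (log_nonneg ((one_le_div hm).mpr hm1.le)),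
    ← ENNReal.ofReal_add (by positivity) (by positivity), ENNReal.ofReal_le_ofReal_iff
      (mul_nonneg (log_nonneg ((one_le_div hm).mpr hm1.le)) two_pi_pos.le), ← add_mul,
    mul_le_mul_iff_left₀ two_pi_pos, log_div (by positivity) (by positivity),
    log_div (by positivity) (by positivity), log_inv, hm_def, log_mul hq.ne' hε.ne'] at hfin
  have h5 : log q⁻¹ < log r := log_lt_log (inv_pos.mpr hq) hqr
  rw [log_inv] at h5
  linarith

theorem isSimplyConnected_ball_zero_one : IsSimplyConnected (ball (0 : ℂ) 1) := by
  have := (convex_ball (0 : ℂ) 1).contractibleSpace ⟨0, mem_ball_self one_pos⟩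
  exact SimplyConnectedSpace.ofContractible _

/-- The **Koebe one-quarter theorem**. -/
theorem norm_deriv_le_four_mul_of_injOn {h : ℂ → ℂ} (hh : DifferentiableOn ℂ h (ball 0 1))
    (hinj : InjOn h (ball 0 1)) {p : ℂ} (hp : ∀ z ∈ ball (0 : ℂ) 1, h z ≠ p) :
    ‖deriv h 0‖ ≤ 4 * ‖h 0 - p‖ := by
  have h00 : (0 : ℂ) ∈ ball (0 : ℂ) 1 := mem_ball_self one_pos
  obtain ⟨φ, hφ, hφd⟩ := exists_differentiableOn_sq_eq isOpen_ball isSimplyConnected_ball_zero_one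
    (hh.sub_const p) fun z hz => sub_ne_zero.mpr (hp z hz)
  have hder : ∀ z, deriv (fun z => h z - p) z = deriv h z := fun z => deriv_sub_const _
  have hφ0 : ∀ z ∈ ball (0 : ℂ) 1, φ z ≠ 0 := fun z hz h0 => hp z hz <| by
    have := hφ z
    rw [h0, zero_pow two_ne_zero] at this
    exact (sub_eq_zero.mp this.symm)
  have hφinj : ∀ z ∈ ball (0 : ℂ) 1, ∀ w ∈ ball (0 : ℂ) 1, φ z ^ 2 = φ w ^ 2 → z = w :=
    fun z hz w hw e => by
      rw [hφ, hφ, sub_left_inj] at e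
      exact hinj hz hw e
  have hne : ∀ z ∈ ball (0 : ℂ) 1, ∀ w ∈ ball (0 : ℂ) 1, φ z + φ w ≠ 0 := fun z hz w hw e => by
    have e' : φ z = -φ w := eq_neg_of_add_eq_zero_left e
    have hzw : z = w := hφinj z hz w hw (by rw [e', neg_sq])
    rw [hzw, ← two_mul] at e
    exact hφ0 w hw ((mul_eq_zero.mp e).resolve_left two_ne_zero)
  set b := φ 0 with hb
  have hb0 : b ≠ 0 := hφ0 0 h00
  have hGd : ∀ z ∈ ball (0 : ℂ) 1, HasDerivAt (fun z => (φ z - b) / (φ z + b))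
      (deriv h z / (2 * φ z) * (2 * b) / (φ z + b) ^ 2) z := fun z hz => by
    have h1 := hφd z hz
    refine ((h1.sub_const b).div (h1.add_const b) (hne z hz 0 h00)).congr_deriv ?_
    rw [hder]
    ring
  have key := norm_deriv_le_one_of_mul_ne_one (G := fun z => (φ z - b) / (φ z + b))
    (fun z hz => (hGd z hz).differentiableAt.differentiableWithinAt) ?_ ?_ ?_
  · rw [(hGd 0 h00).deriv] at key
    have e : deriv h 0 / (2 * φ 0) * (2 * b) / (φ 0 + b) ^ 2 = deriv h 0 / (4 * φ 0 ^ 2) := by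
      rw [← hb]
      field_simp
      ring
    rw [e, norm_div, hφ, div_le_one (norm_pos_iff.mpr (mul_ne_zero (by norm_num)
      (sub_ne_zero.mpr (hp 0 h00)))), norm_mul] at key
    simpa using key
  · intro z hz w hw e
    simp only at e
    rw [div_eq_div_iff (hne z hz 0 h00) (hne w hw 0 h00)] at e
    have e' : 2 * b * (φ z - φ w) = 0 := by linear_combination e
    have : φ z = φ w := sub_eq_zero.mp ((mul_eq_zero.mp e').resolve_left (by simpa using hb0))
    exact hφinj z hz w hw (by rw [this])
  · simp [← hb]
  · intro z hz w hw e
    rw [div_mul_div_comm, div_eq_one_iff_eq (mul_ne_zero (hne z hz 0 h00) (hne w hw 0 h00))] at e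
    have e' : 2 * b * (φ z + φ w) = 0 := by linear_combination -e
    exact hne z hz w hw ((mul_eq_zero.mp e').resolve_left (by simpa using hb0))

/-- The hyperbolic density of a domain is bounded below by the inverse distance to the boundary. -/
theorem one_sub_norm_sq_le_four_mul {U : Set ℂ} (hUo : IsOpen U) {f : ℂ → ℂ}
    (himg : f '' U = ball 0 1) (hinj : InjOn f U) (hd : ∀ z ∈ U, deriv f z ≠ 0) {z p : ℂ}
    (hz : z ∈ U) (hp : p ∉ U) :
    1 - ‖f z‖ ^ 2 ≤ 4 * (‖deriv f z‖ * ‖z - p‖) := by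
  have hf : DifferentiableOn ℂ f U := fun w hw =>
    (differentiableAt_of_deriv_ne_zero (hd w hw)).differentiableWithinAt
  set g := Function.invFunOn f U with hg
  have hgmem : ∀ w ∈ ball (0 : ℂ) 1, g w ∈ U := fun w hw =>
    Function.invFunOn_mem (by rwa [← himg] at hw)
  have hfg : ∀ w ∈ ball (0 : ℂ) 1, f (g w) = w := fun w hw =>
    Function.invFunOn_eq (by rwa [← himg] at hw)
  have hgf : ∀ w ∈ U, g (f w) = w := hinj.leftInvOn_invFunOn
  have hgd : ∀ w ∈ ball (0 : ℂ) 1, HasDerivAt g (deriv f (g w))⁻¹ w := fun w hw => by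
    have hs : HasStrictDerivAt f (deriv f (g w)) (g w) :=
      (hf.analyticAt (hUo.mem_nhds (hgmem w hw))).hasStrictDerivAt
    have := hs.to_local_left_inverse (hd _ (hgmem w hw))
      (eventually_of_mem (hUo.mem_nhds (hgmem w hw)) hgf)
    rw [hfg w hw] at this
    exact this.hasDerivAt
  have hfz : f z ∈ ball (0 : ℂ) 1 := himg ▸ mem_image_of_mem f hz
  have hfz1 : ‖-f z‖ < 1 := by rw [norm_neg]; exact mem_ball_zero_iff.mp hfz
  have hmob : ∀ w ∈ ball (0 : ℂ) 1, diskMobius (-f z) w ∈ ball (0 : ℂ) 1 := fun w hw =>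
    mem_ball_zero_iff.mpr (norm_diskMobius_lt_one hfz1 (mem_ball_zero_iff.mp hw))
  have hhd : ∀ w ∈ ball (0 : ℂ) 1, HasDerivAt (g ∘ diskMobius (-f z)) _ w := fun w hw =>
    (hgd _ (hmob w hw)).comp w (hasDerivAt_diskMobius hfz1 (mem_ball_zero_iff.mp hw))
  have h00 : (0 : ℂ) ∈ ball (0 : ℂ) 1 := mem_ball_self one_pos
  have key := norm_deriv_le_four_mul_of_injOn (h := g ∘ diskMobius (-f z)) (p := p)
    (fun w hw => (hhd w hw).differentiableAt.differentiableWithinAt)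
    (fun a ha b hb e => diskMobius_injOn hfz1 ha hb (by
      rw [← hfg _ (hmob a ha), ← hfg _ (hmob b hb)]; exact congrArg f e))
    fun w hw e => hp (e ▸ hgmem _ (hmob w hw))
  rw [(hhd 0 h00).deriv] at key
  simp only [Function.comp_apply, diskMobius_zero, neg_neg, hgf z hz, mul_zero, sub_zero,
    one_pow, div_one, norm_neg, norm_mul, norm_inv] at key
  have h1 : ‖(1 : ℂ) - (‖f z‖ : ℂ) ^ 2‖ = 1 - ‖f z‖ ^ 2 := by
    have h2 : ‖f z‖ ^ 2 ≤ 1 := by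
      rw [norm_neg] at hfz1
      exact pow_le_one₀ (norm_nonneg _) hfz1.le
    rw [← Complex.norm_of_nonneg (sub_nonneg.mpr h2)]
    push_cast
    rfl
  have hd0 : 0 < ‖deriv f z‖ := norm_pos_iff.mpr (hd z hz)
  rw [h1, inv_mul_le_iff₀ hd0] at key
  linarith

/-- Every simply connected proper planar domain carries a holomorphic function with positive
imaginary part whose logarithmic derivative (in the sense of the hyperbolic metric of the half
plane) dominates the inverse distance to the boundary. -/
theorem exists_upperHalfPlane_map {U : Set ℂ} (hUo : IsOpen U) (hUc : IsSimplyConnected U)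
    (hU : U ≠ univ) :
    ∃ g : ℂ → ℂ, DifferentiableOn ℂ g U ∧ (∀ z ∈ U, 0 < (g z).im) ∧
      ∀ z ∈ U, (g z).im ≤ 2 * (‖deriv g z‖ * infDist z Uᶜ) := by
  obtain ⟨f, himg, hinj, hd⟩ := exists_riemann_map hUo hUc hU
  have hlt : ∀ z ∈ U, ‖f z‖ < 1 := fun z hz =>
    mem_ball_zero_iff.mp (himg ▸ mem_image_of_mem f hz)
  have hne : ∀ z ∈ U, 1 - f z ≠ 0 := fun z hz h => by
    have := hlt z hz
    rw [← sub_eq_zero.mp h, norm_one] at this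
    exact lt_irrefl _ this
  have hgd : ∀ z ∈ U, HasDerivAt (fun z => Complex.I * (1 + f z) / (1 - f z))
      (2 * Complex.I * deriv f z / (1 - f z) ^ 2) z := fun z hz => by
    have h1 := (differentiableAt_of_deriv_ne_zero (hd z hz)).hasDerivAt
    refine (((h1.const_add 1).const_mul Complex.I).div (h1.const_sub 1) (hne z hz)).congr_deriv ?_
    ring
  have him : ∀ z ∈ U, (Complex.I * (1 + f z) / (1 - f z)).im
      = (1 - ‖f z‖ ^ 2) / ‖1 - f z‖ ^ 2 := fun z hz => by
    have h1 : Complex.normSq (1 - f z) ≠ 0 := by simpa using hne z hz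
    rw [Complex.div_im, Complex.sq_norm, Complex.sq_norm]
    field_simp
    simp [Complex.normSq_apply]
    ring
  have hpos : ∀ z ∈ U, 0 < 1 - ‖f z‖ ^ 2 := fun z hz =>
    sub_pos.mpr (pow_lt_one₀ (norm_nonneg _) (hlt z hz) two_ne_zero)
  refine ⟨_, fun z hz => (hgd z hz).differentiableAt.differentiableWithinAt, fun z hz => ?_,
    fun z hz => ?_⟩
  · rw [him z hz]
    exact div_pos (hpos z hz) (pow_pos (norm_pos_iff.mpr (hne z hz)) 2)
  · have hcne : Uᶜ.Nonempty := nonempty_compl.mpr hU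
    obtain ⟨p, hp, hdist⟩ := hUo.isClosed_compl.exists_infDist_eq_dist hcne z
    have key := one_sub_norm_sq_le_four_mul hUo himg hinj hd hz hp
    rw [him z hz, (hgd z hz).deriv, hdist, dist_eq_norm, norm_div, norm_mul, norm_mul, norm_pow,
      div_le_iff₀ (pow_pos (norm_pos_iff.mpr (hne z hz)) 2)]
    have h2 : ‖1 - f z‖ ≠ 0 := norm_ne_zero_iff.mpr (hne z hz)
    simp only [Complex.norm_I, Complex.norm_ofNat, mul_one]
    field_simp
    linarith

theorem integral_fderiv_apply_eq_zero {E : Type*} [NormedAddCommGroup E] [NormedSpace ℝ E]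
    [MeasurableSpace E] [BorelSpace E] [FiniteDimensional ℝ E] {μ : Measure E}
    [μ.IsAddHaarMeasure] {F : E → ℝ} (hF : ContDiff ℝ 1 F) (hc : HasCompactSupport F) (v : E) :
    ∫ x, fderiv ℝ F x v ∂μ = 0 := by
  have hi : Integrable (fun x => fderiv ℝ F x v) μ :=
    ((hF.continuous_fderiv one_ne_zero).clm_apply continuous_const).integrable_of_hasCompactSupport
      (hc.fderiv_apply (𝕜 := ℝ) v)
  have := integral_mul_fderiv_eq_neg_fderiv_mul_of_integrable (μ := μ) (𝕜 := ℝ)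
    (f := fun _ => (1 : ℝ)) (g := F) (v := v) (by simp) (by simpa using hi)
    (by simpa using hF.continuous.integrable_of_hasCompactSupport hc)
    (fun _ _ => differentiableAt_const _) (fun _ _ => (hF.differentiable one_ne_zero) _)
  simpa using this

theorem HasLineDerivAt.sq_mul_div {E : Type*} [NormedAddCommGroup E] [NormedSpace ℝ E]
    {u A B : E → ℝ} {u' A' B' : ℝ} {x v : E} (hu : HasLineDerivAt ℝ u u' x v)
    (hA : HasLineDerivAt ℝ A A' x v) (hB : HasLineDerivAt ℝ B B' x v) (hB0 : B x ≠ 0) :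
    HasLineDerivAt ℝ (fun y => u y ^ 2 * (A y / (2 * B y)))
      (2 * u x * u' * (A x / (2 * B x)) + u x ^ 2 * (A' / (2 * B x) - A x * B' / (2 * B x ^ 2)))
      x v := by
  unfold HasLineDerivAt at *
  have h0 : x + (0 : ℝ) • v = x := by simp
  have := (hu.pow 2).mul (hA.div (hB.const_mul 2) (by simpa [h0] using hB0))
  refine this.congr_deriv ?_
  simp only [h0, Pi.pow_apply, Pi.div_apply]
  field_simp
  ring

theorem sq_add_sq_le_norm_sq (L : ℂ →L[ℝ] ℝ) : L 1 ^ 2 + L Complex.I ^ 2 ≤ ‖L‖ ^ 2 := by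
  have h := L.le_opNorm (L 1 + L Complex.I * Complex.I)
  have e : L (L 1 + L Complex.I * Complex.I) = L 1 ^ 2 + L Complex.I ^ 2 := by
    have : (L 1 + L Complex.I * Complex.I : ℂ) = L 1 • (1 : ℂ) + L Complex.I • Complex.I := by
      simp
    rw [this, map_add, map_smul, map_smul, smul_eq_mul, smul_eq_mul, sq, sq]
  have hn : ‖(L 1 + L Complex.I * Complex.I : ℂ)‖ ^ 2 = L 1 ^ 2 + L Complex.I ^ 2 := by
    rw [Complex.sq_norm, Complex.normSq_add_mul_I]
  rw [e, Real.norm_of_nonneg (by positivity), ← hn] at h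
  rw [← hn]
  rcases (norm_nonneg (L 1 + L Complex.I * Complex.I : ℂ)).eq_or_lt with h0 | h0
  · rw [← h0]
    simp
  · rw [sq, mul_le_mul_iff_left₀ h0] at h
    gcongr

/-- Pointwise Hardy inequality, up to the divergence of a compactly supported vector field, with
the weight given by a holomorphic function with positive imaginary part. -/
theorem exists_divergence_le {U : Set ℂ} (hUo : IsOpen U) {g : ℂ → ℂ}
    (hg : DifferentiableOn ℂ g U) (hpos : ∀ z ∈ U, 0 < (g z).im) {u : ℂ → ℝ}
    (hu : ContDiff ℝ 1 u) (hs : tsupport u ⊆ U) :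
    ∃ F₁ F₂ : ℂ → ℝ, ContDiff ℝ 1 F₁ ∧ ContDiff ℝ 1 F₂ ∧ tsupport F₁ ⊆ tsupport u ∧
      tsupport F₂ ⊆ tsupport u ∧ ∀ z ∈ U, u z ^ 2 * (‖deriv g z‖ ^ 2 / (4 * (g z).im ^ 2)) ≤
        ‖fderiv ℝ u z‖ ^ 2 - (fderiv ℝ F₁ z 1 + fderiv ℝ F₂ z Complex.I) := by
  have hg1 : DifferentiableOn ℂ (deriv g) U := hg.deriv hUo
  have hsupp : ∀ a : ℂ → ℝ, tsupport (fun z => u z ^ 2 * a z) ⊆ tsupport u := fun a =>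
    closure_mono fun z hz h => hz (by simp [h])
  have hsm : ∀ {f : ℂ → ℂ}, DifferentiableOn ℂ f U → ∀ z ∈ U, ContDiffAt ℝ 1 f z :=
    fun hf z hz => ((hf.analyticAt (hUo.mem_nhds hz)).contDiffAt).restrict_scalars ℝ
  have hCD : ∀ A : ℂ → ℝ, (∀ z ∈ U, ContDiffAt ℝ 1 A z) →
      ContDiff ℝ 1 (fun z => u z ^ 2 * (A z / (2 * (g z).im))) := fun A hA =>
    contDiff_iff_contDiffAt.mpr fun z => by
      by_cases hz : z ∈ tsupport (fun z => u z ^ 2 * (A z / (2 * (g z).im)))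
      swap
      · exact contDiffAt_const.congr_of_eventuallyEq (notMem_tsupport_iff_eventuallyEq.mp hz)
      have hz' := hs (hsupp _ hz)
      refine (hu.contDiffAt.pow 2).mul ((hA z hz').div (contDiffAt_const.mul ?_) ?_)
      · exact Complex.imCLM.contDiff.contDiffAt.comp z (hsm hg z hz')
      · exact mul_ne_zero two_ne_zero (hpos z hz').ne'
  have hC₁ := hCD (fun z => (deriv g z).im) fun z hz =>
    Complex.imCLM.contDiff.contDiffAt.comp z (hsm hg1 z hz)
  have hC₂ := hCD (fun z => (deriv g z).re) fun z hz =>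
    Complex.reCLM.contDiff.contDiffAt.comp z (hsm hg1 z hz)
  refine ⟨_, _, hC₁, hC₂, hsupp _, hsupp _, fun z hz => ?_⟩
  have hfd : ∀ {f : ℂ → ℂ}, DifferentiableOn ℂ f U →
      HasFDerivAt f (deriv f z • (1 : ℂ →L[ℝ] ℂ)) z := fun hf =>
    ((hf.differentiableAt (hUo.mem_nhds hz)).hasDerivAt).complexToReal_fderiv
  have him : ∀ {f : ℂ → ℂ}, DifferentiableOn ℂ f U → ∀ v,
      HasLineDerivAt ℝ (fun z => (f z).im) (deriv f z * v).im z v := fun hf v =>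
    (Complex.imCLM.hasFDerivAt.comp z (hfd hf)).hasLineDerivAt v
  have hre : ∀ {f : ℂ → ℂ}, DifferentiableOn ℂ f U → ∀ v,
      HasLineDerivAt ℝ (fun z => (f z).re) (deriv f z * v).re z v := fun hf v =>
    (Complex.reCLM.hasFDerivAt.comp z (hfd hf)).hasLineDerivAt v
  have hul : ∀ v, HasLineDerivAt ℝ u (fderiv ℝ u z v) z v := fun v =>
    ((hu.differentiable one_ne_zero) z).hasFDerivAt.hasLineDerivAt v
  have h₁ := (hul 1).sq_mul_div (him hg1 1) (him hg 1) (hpos z hz).ne'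
  have h₂ := (hul Complex.I).sq_mul_div (hre hg1 Complex.I) (him hg Complex.I) (hpos z hz).ne'
  rw [← ((hC₁.differentiable one_ne_zero) z).lineDeriv_eq_fderiv,
    ← ((hC₂.differentiable one_ne_zero) z).lineDeriv_eq_fderiv, h₁.lineDeriv, h₂.lineDeriv]
  have hL := sq_add_sq_le_norm_sq (fderiv ℝ u z)
  have hy := (hpos z hz).ne'
  simp only [mul_one, Complex.mul_I_im, Complex.mul_I_re]
  rw [Complex.sq_norm, Complex.normSq_apply]
  set a := fderiv ℝ u z 1
  set b := fderiv ℝ u z Complex.I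
  set x := (deriv g z).re
  set t := (deriv g z).im
  set y := (g z).im
  refine le_trans ?_ (sub_le_sub_right hL _)
  rw [← sub_nonneg]
  have : 0 ≤ (a - u z * (t / (2 * y))) ^ 2 + (b - u z * (x / (2 * y))) ^ 2 := by positivity
  refine this.trans_eq ?_
  field_simp
  ring

theorem hardy_simply_connected_complex {U : Set ℂ} (hUo : IsOpen U) (hUc : IsSimplyConnected U)
    (hU : U ≠ univ) {u : ℂ → ℝ} (hu : ContDiff ℝ 1 u) (hc : HasCompactSupport u)
    (hs : tsupport u ⊆ U) :
    (1 / 16 : ℝ) * ∫ z in U, u z ^ 2 / infDist z Uᶜ ^ 2 ≤ ∫ z in U, ‖fderiv ℝ u z‖ ^ 2 := by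
  obtain ⟨g, hg, hpos, hle⟩ := exists_upperHalfPlane_map hUo hUc hU
  obtain ⟨F₁, F₂, hF₁, hF₂, hs₁, hs₂, hF⟩ := exists_divergence_le hUo hg hpos hu hs
  have hc₁ : HasCompactSupport F₁ := hc.of_isClosed_subset (isClosed_tsupport _) hs₁
  have hc₂ : HasCompactSupport F₂ := hc.of_isClosed_subset (isClosed_tsupport _) hs₂
  have hI : ∀ {F : ℂ → ℝ}, ContDiff ℝ 1 F → HasCompactSupport F → ∀ v,
      Integrable (fun z => fderiv ℝ F z v) := fun hF hc v =>
    ((hF.continuous_fderiv one_ne_zero).clm_apply continuous_const).integrable_of_hasCompactSupport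
      (hc.fderiv_apply (𝕜 := ℝ) v)
  have hset : ∀ {F : ℂ → ℝ}, tsupport F ⊆ tsupport u → ∀ v,
      ∫ z in U, fderiv ℝ F z v = ∫ z, fderiv ℝ F z v := fun hF v =>
    setIntegral_eq_integral_of_forall_compl_eq_zero fun z hz => by
      by_contra h
      exact hz (hs (hF (tsupport_fderiv_apply_subset ℝ v (subset_tsupport _ h))))
  have hIu : Integrable (fun z => ‖fderiv ℝ u z‖ ^ 2) :=
    ((hu.continuous_fderiv one_ne_zero).norm.pow 2).integrable_of_hasCompactSupport
      (hc.mono' fun z hz => support_fderiv_subset ℝ fun h => hz (by simp [h]))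
  have hdiv : IntegrableOn (fun z => fderiv ℝ F₁ z 1 + fderiv ℝ F₂ z Complex.I) U :=
    ((hI hF₁ hc₁ 1).add (hI hF₂ hc₂ Complex.I)).integrableOn
  have h0 : ∫ z in U, (fderiv ℝ F₁ z 1 + fderiv ℝ F₂ z Complex.I) = 0 := by
    rw [integral_add (hI hF₁ hc₁ 1).integrableOn (hI hF₂ hc₂ Complex.I).integrableOn, hset hs₁,
      hset hs₂, integral_fderiv_apply_eq_zero hF₁ hc₁, integral_fderiv_apply_eq_zero hF₂ hc₂,
      add_zero]
  rw [← sub_zero (∫ z in U, ‖fderiv ℝ u z‖ ^ 2), ← h0, ← integral_sub hIu.integrableOn hdiv,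
    ← integral_const_mul]
  refine integral_mono_of_nonneg (.of_forall fun z => by positivity) (hIu.integrableOn.sub hdiv) ?_
  filter_upwards [ae_restrict_mem hUo.measurableSet] with z hz
  refine le_trans ?_ (hF z hz)
  have hd : 0 < infDist z Uᶜ := (hUo.isClosed_compl.notMem_iff_infDist_pos
    (nonempty_compl.mpr hU)).mp (not_not.mpr hz)
  have hy := hpos z hz
  have h1 : (g z).im ^ 2 ≤ (2 * (‖deriv g z‖ * infDist z Uᶜ)) ^ 2 :=
    pow_le_pow_left₀ hy.le (hle z hz) 2
  rw [one_div_mul_eq_div, div_div, mul_div_assoc', div_le_div_iff₀ (by positivity) (by positivity)]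
  nlinarith [mul_le_mul_of_nonneg_left h1 (sq_nonneg (u z))]

end

/-- **Ancona's theorem.**
If `Ω ⊊ ℝ²` is a nonempty open simply connected set, then for every `u ∈ C_c^∞(Ω)`,
`∫_Ω ‖∇u‖² ≥ (1/16) ∫_Ω u²/d²`. -/
theorem hardy_simply_connected_sixteenth
    (Ω : Set (EuclideanSpace ℝ (Fin 2)))
    (hopen : IsOpen Ω) (hne : Ω.Nonempty) (hproper : Ω ≠ Set.univ)
    (hsc : SimplyConnectedSpace Ω)
    (u : EuclideanSpace ℝ (Fin 2) → ℝ)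
    (hu : ContDiff ℝ (⊤ : ℕ∞) u) (hcpt : HasCompactSupport u) (hsupp : tsupport u ⊆ Ω) :
    (1 / 16 : ℝ) * ∫ x in Ω, u x ^ 2 / Metric.infDist x Ωᶜ ^ 2
      ≤ ∫ x in Ω, ‖gradient u x‖ ^ 2 := by
  let e : ℂ ≃ₗᵢ[ℝ] EuclideanSpace ℝ (Fin 2) := Complex.orthonormalBasisOneI.repr
  have hmp : MeasurePreserving e := e.measurePreserving
  have hme : MeasurableEmbedding e := e.toHomeomorph.measurableEmbedding
  have hcov : ∀ Φ : EuclideanSpace ℝ (Fin 2) → ℝ,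
      ∫ x in Ω, Φ x = ∫ z in e ⁻¹' Ω, Φ (e z) := fun Φ =>
    (hmp.setIntegral_preimage_emb hme Φ Ω).symm
  have hdist : ∀ z, Metric.infDist (e z) Ωᶜ = Metric.infDist z (e ⁻¹' Ω)ᶜ := fun z => by
    rw [← Metric.infDist_image e.isometry, ← Set.preimage_compl,
      Set.image_preimage_eq _ e.surjective]
  have hgrad : ∀ z, ‖fderiv ℝ (u ∘ e) z‖ = ‖gradient u (e z)‖ := fun z => by
    rw [gradient, LinearIsometryEquiv.norm_map,
      fderiv_comp z (hu.differentiable (by simp) _) e.differentiableAt, e.fderiv]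
    exact ContinuousLinearMap.opNorm_comp_linearIsometryEquiv _ e
  rw [hcov, hcov]
  simp only [hdist, ← hgrad]
  have hsupp' : tsupport (u ∘ e) = e ⁻¹' tsupport u :=
    tsupport_comp_eq_preimage u e.toHomeomorph
  refine hardy_simply_connected_complex (hopen.preimage e.continuous)
    (e.toHomeomorph.isSimplyConnected_preimage.mpr hsc) ?_ ?_ ?_ ?_
  · rwa [Ne, Set.preimage_eq_univ_iff, e.surjective.range_eq, Set.univ_subset_iff]
  · exact (hu.of_le (by exact_mod_cast le_top)).comp e.contDiff
  · exact hcpt.comp_homeomorph e.toHomeomorph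
  · exact hsupp'.subset.trans (Set.preimage_mono hsupp)
end

section
/- Let β ∈ [π, 2π] and let Λ_β = {(r cos θ, r sin θ) : r > 0, 0 < θ < β} ⊂ ℝ² be the infinite sector of angle β. Then the L² Hardy constant H(Λ_β) equals c_β, the best (largest) constant c such that ∫_0^β g'(θ)² dθ ≥ c ∫_0^β g(θ)² V_β(θ) dθ for all g ∈ C_c^∞((0, β)), where V_β(θ) = 1/sin²θ for 0 < θ < π/2, V_β(θ) = 1 for π/2 < θ < β − π/2, and V_β(θ) = 1/sin²(β − θ) for β − π/2 < θ < β. -/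
open MeasureTheory Real

/-- The infinite planar sector of angle `β`. -/
def sector (β : ℝ) : Set (EuclideanSpace ℝ (Fin 2)) :=
  {p | ∃ r θ : ℝ, 0 < r ∧ 0 < θ ∧ θ < β ∧ p 0 = r * Real.cos θ ∧ p 1 = r * Real.sin θ}

/-- The `L²` Hardy constant of an open set `Ω ⊆ ℝⁿ`: the supremum of constants `c ≥ 0`
such that `∫_Ω ‖∇u‖² ≥ c ∫_Ω u²/d²` for all `u ∈ C_c^∞(Ω)`, where `d(x) = dist(x, Ωᶜ)`. -/
noncomputable def hardyConst {n : ℕ} (Ω : Set (EuclideanSpace ℝ (Fin n))) : ℝ :=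
  sSup {c : ℝ | 0 ≤ c ∧ ∀ u : EuclideanSpace ℝ (Fin n) → ℝ,
    ContDiff ℝ (⊤ : ℕ∞) u → HasCompactSupport u → tsupport u ⊆ Ω →
    c * ∫ x in Ω, u x ^ 2 / Metric.infDist x Ωᶜ ^ 2 ≤ ∫ x in Ω, ‖gradient u x‖ ^ 2}

/-- The weight `V_β` on `(0, β)`. -/
noncomputable def sectorWeight (β θ : ℝ) : ℝ :=
  if θ < Real.pi / 2 then 1 / Real.sin θ ^ 2
  else if θ < β - Real.pi / 2 then 1
  else 1 / Real.sin (β - θ) ^ 2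

/-- The point of the plane with polar coordinates `(r, θ)`. -/
noncomputable def polarPoint (r θ : ℝ) : EuclideanSpace ℝ (Fin 2) :=
  !₂[r * Real.cos θ, r * Real.sin θ]

@[simp] lemma polarPoint_apply_zero (r θ : ℝ) : polarPoint r θ 0 = r * Real.cos θ := rfl

@[simp] lemma polarPoint_apply_one (r θ : ℝ) : polarPoint r θ 1 = r * Real.sin θ := rfl

lemma continuous_polarPoint : Continuous fun p : ℝ × ℝ ↦ polarPoint p.1 p.2 := by
  unfold polarPoint
  fun_prop

lemma exists_eq_polarPoint (y : EuclideanSpace ℝ (Fin 2)) :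
    ∃ r θ : ℝ, 0 ≤ r ∧ 0 < θ ∧ θ ≤ 2 * Real.pi ∧ y = polarPoint r θ := by
  let z : ℂ := ⟨-y 0, -y 1⟩
  refine ⟨‖z‖, z.arg + Real.pi, norm_nonneg _, by linarith [Complex.neg_pi_lt_arg z],
    by linarith [Complex.arg_le_pi z], ?_⟩
  ext i
  fin_cases i
  · have := Complex.norm_mul_cos_arg z
    simp only [Fin.zero_eta, polarPoint_apply_zero, Real.cos_add_pi]
    simp only [z] at this ⊢
    linarith
  · have := Complex.norm_mul_sin_arg z
    simp only [Fin.mk_one, polarPoint_apply_one, Real.sin_add_pi]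
    simp only [z] at this ⊢
    linarith

lemma polarPoint_mem_sector {β r θ : ℝ} (hr : 0 < r) (h0 : 0 < θ) (hθ : θ < β) :
    polarPoint r θ ∈ sector β :=
  ⟨r, θ, hr, h0, hθ, rfl, rfl⟩

lemma polarPoint_injOn {r r' θ θ' : ℝ} (hr : 0 ≤ r) (hr' : 0 < r')
    (h1 : -(2 * Real.pi) < θ - θ') (h2 : θ - θ' < 2 * Real.pi)
    (hc : r * Real.cos θ = r' * Real.cos θ') (hs : r * Real.sin θ = r' * Real.sin θ') :
    r = r' ∧ θ = θ' := by
  have hsq : r ^ 2 = r' ^ 2 := by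
    have e1 := Real.sin_sq_add_cos_sq θ
    have e2 := Real.sin_sq_add_cos_sq θ'
    calc r ^ 2 = (r * Real.cos θ) ^ 2 + (r * Real.sin θ) ^ 2 := by linear_combination -r ^ 2 * e1
      _ = r' ^ 2 := by rw [hc, hs]; linear_combination r' ^ 2 * e2
  have hrr : r = r' := (pow_left_inj₀ hr hr'.le two_ne_zero).1 hsq
  subst hrr
  refine ⟨rfl, ?_⟩
  have hc' := mul_left_cancel₀ hr'.ne' hc
  have hs' := mul_left_cancel₀ hr'.ne' hs
  have : Real.cos (θ - θ') = 1 := by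
    rw [Real.cos_sub, hc', hs']
    linear_combination Real.sin_sq_add_cos_sq θ'
  linarith [(Real.cos_eq_one_iff_of_lt_of_lt h1 h2).1 this]

lemma pos_of_polarPoint_mem_sector {β r θ : ℝ} (hβ : β ≤ 2 * Real.pi) (hr : 0 ≤ r) (h0 : 0 ≤ θ)
    (hθ : θ ≤ 2 * Real.pi) (h : polarPoint r θ ∈ sector β) : 0 < r ∧ 0 < θ ∧ θ < β := by
  obtain ⟨r', θ', hr', h0', hθ', hc, hs⟩ := h
  obtain ⟨rfl, rfl⟩ := polarPoint_injOn hr hr' (by linarith) (by linarith) hc hs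
  exact ⟨hr', h0', hθ'⟩

lemma zero_notMem_sector (β : ℝ) : (0 : EuclideanSpace ℝ (Fin 2)) ∉ sector β := by
  rintro ⟨r, θ, hr, -, -, hc, hs⟩
  have e := Real.sin_sq_add_cos_sq θ
  simp only [PiLp.zero_apply, zero_eq_mul, hr.ne', false_or] at hc hs
  simp [hc, hs] at e

lemma exists_eq_polarPoint_of_notMem_sector {β : ℝ} {y : EuclideanSpace ℝ (Fin 2)}
    (hβ : β ≤ 2 * Real.pi) (hy : y ∉ sector β) :
    ∃ r θ : ℝ, 0 ≤ r ∧ β ≤ θ ∧ θ ≤ 2 * Real.pi ∧ y = polarPoint r θ := by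
  obtain ⟨r, θ, hr, h0, hθ, rfl⟩ := exists_eq_polarPoint y
  rcases hr.eq_or_lt with rfl | hr
  · refine ⟨0, 2 * Real.pi, le_rfl, hβ, le_rfl, ?_⟩
    ext i
    fin_cases i <;> simp
  · exact ⟨r, θ, hr.le, not_lt.1 fun h ↦ hy (polarPoint_mem_sector hr h0 h), hθ, rfl⟩

lemma dist_polarPoint_sq (r θ s α : ℝ) :
    dist (polarPoint r θ) (polarPoint s α) ^ 2 = r ^ 2 + s ^ 2 - 2 * r * s * Real.cos (θ - α) := by
  rw [EuclideanSpace.dist_eq, Real.sq_sqrt (by positivity), Real.cos_sub]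
  simp only [Fin.sum_univ_two, Real.dist_eq, sq_abs, polarPoint_apply_zero, polarPoint_apply_one]
  linear_combination r ^ 2 * Real.sin_sq_add_cos_sq θ + s ^ 2 * Real.sin_sq_add_cos_sq α

lemma infDist_eq_of_mem_of_forall_le {α : Type*} [PseudoMetricSpace α] {s : Set α} {x y : α} {d : ℝ}
    (hy : y ∈ s) (hxy : dist x y = d) (h : ∀ z ∈ s, d ≤ dist x z) : Metric.infDist x s = d :=
  le_antisymm (hxy ▸ Metric.infDist_le_dist_of_mem hy) ((Metric.le_infDist ⟨y, hy⟩).2 h)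

/-- Distance to the line through the origin with direction `γ` bounds from below the distance to
any point on the other side of this line. -/
lemma mul_sin_le_dist_polarPoint {r θ s α γ : ℝ} (h : 0 ≤ r * Real.sin (θ - γ))
    (h' : s * Real.sin (α - γ) ≤ 0) :
    r * Real.sin (θ - γ) ≤ dist (polarPoint r θ) (polarPoint s α) := by
  refine le_of_abs_le (abs_le_of_sq_le_sq ?_ dist_nonneg)
  rw [dist_polarPoint_sq, show θ - α = (θ - γ) - (α - γ) by ring, Real.cos_sub (θ - γ)]
  have e1 := Real.sin_sq_add_cos_sq (θ - γ)
  have e2 := Real.sin_sq_add_cos_sq (α - γ)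
  nlinarith [sq_nonneg (r * Real.cos (θ - γ) - s * Real.cos (α - γ)), mul_nonneg h (neg_nonneg.2 h'),
    sq_nonneg (s * Real.sin (α - γ))]

lemma dist_polarPoint_mul_cos {r θ γ : ℝ} (h : 0 ≤ r * Real.sin (θ - γ)) :
    dist (polarPoint r θ) (polarPoint (r * Real.cos (θ - γ)) γ) = r * Real.sin (θ - γ) := by
  refine (pow_left_inj₀ dist_nonneg h two_ne_zero).1 ?_
  rw [dist_polarPoint_sq]
  linear_combination -r ^ 2 * Real.sin_sq_add_cos_sq (θ - γ)

lemma infDist_sector_compl_sq {β r θ : ℝ} (hβ₁ : Real.pi ≤ β) (hβ₂ : β ≤ 2 * Real.pi)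
    (hr : 0 < r) (h0 : 0 < θ) (hθ : θ < β) :
    (Metric.infDist (polarPoint r θ) (sector β)ᶜ ^ 2)⁻¹ = sectorWeight β θ / r ^ 2 := by
  have hpi := Real.pi_pos
  have mem_compl {s α : ℝ} (hs : 0 ≤ s) (hα0 : 0 ≤ α) (hα : α ≤ 2 * Real.pi)
      (h : α = 0 ∨ β ≤ α) : polarPoint s α ∈ (sector β)ᶜ := fun hmem ↦ by
    have := pos_of_polarPoint_mem_sector hβ₂ hs hα0 hα hmem
    rcases h with h | h <;> linarith
  unfold sectorWeight
  split_ifs with h1 h2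
  · have hsin : 0 < Real.sin θ := Real.sin_pos_of_pos_of_lt_pi h0 (by linarith)
    have hcos : 0 < Real.cos θ := Real.cos_pos_of_mem_Ioo ⟨by linarith, h1⟩
    have hpos : 0 ≤ r * Real.sin (θ - 0) := by rw [sub_zero]; positivity
    rw [infDist_eq_of_mem_of_forall_le (d := r * Real.sin (θ - 0)) (mem_compl (by
      rw [sub_zero]; positivity) le_rfl (by linarith) (.inl rfl)) (dist_polarPoint_mul_cos hpos)]
    · rw [sub_zero]; field_simp
    · intro y hy
      obtain ⟨s, α, hs, hα, hα', rfl⟩ := exists_eq_polarPoint_of_notMem_sector hβ₂ hy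
      refine mul_sin_le_dist_polarPoint hpos (mul_nonpos_of_nonneg_of_nonpos hs ?_)
      have := Real.sin_nonneg_of_nonneg_of_le_pi (x := α - Real.pi) (by linarith) (by linarith)
      rw [Real.sin_sub_pi] at this
      simpa using this
  · rw [infDist_eq_of_mem_of_forall_le (y := (0 : EuclideanSpace ℝ (Fin 2))) (d := r)
      (zero_notMem_sector β)]
    · simp
    · refine (pow_left_inj₀ dist_nonneg hr.le two_ne_zero).1 ?_
      have := dist_polarPoint_sq r θ 0 0
      rwa [show polarPoint 0 0 = 0 by ext i; fin_cases i <;> simp, zero_pow two_ne_zero, mul_zero,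
        zero_mul, add_zero, sub_zero] at this
    · intro y hy
      obtain ⟨s, α, hs, hα, hα', rfl⟩ := exists_eq_polarPoint_of_notMem_sector hβ₂ hy
      refine le_of_abs_le (abs_le_of_sq_le_sq ?_ dist_nonneg)
      have hcos : Real.cos (α - θ) ≤ 0 :=
        Real.cos_nonpos_of_pi_div_two_le_of_le (by linarith) (by linarith)
      rw [← neg_sub, Real.cos_neg] at hcos
      rw [dist_polarPoint_sq]
      nlinarith [mul_nonneg (mul_nonneg hr.le hs) (neg_nonneg.2 hcos), sq_nonneg s]
  · have hgt : β - Real.pi / 2 ≤ θ := not_lt.1 h2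
    have hsin : 0 < Real.sin (β - θ) := Real.sin_pos_of_pos_of_lt_pi (by linarith) (by linarith)
    have hcos : 0 ≤ Real.cos (β - θ) := Real.cos_nonneg_of_mem_Icc ⟨by linarith, by linarith⟩
    -- the line through the origin with direction `β`, oriented so that the sector is on the left
    have hγ (x : ℝ) : Real.sin (x - (β - Real.pi)) = Real.sin (β - x) := by
      rw [show x - (β - Real.pi) = Real.pi - (β - x) by ring, Real.sin_pi_sub]
    have hpos : 0 ≤ r * Real.sin (θ - (β - Real.pi)) := by rw [hγ]; positivity
    rw [infDist_eq_of_mem_of_forall_le (d := r * Real.sin (θ - (β - Real.pi)))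
      (y := polarPoint (r * Real.cos (θ - (β - Real.pi))) (β - Real.pi)) ?_
      (dist_polarPoint_mul_cos hpos)]
    · rw [hγ]; field_simp
    · intro y hy
      obtain ⟨s, α, hs, hα, hα', rfl⟩ := exists_eq_polarPoint_of_notMem_sector hβ₂ hy
      refine mul_sin_le_dist_polarPoint hpos (mul_nonpos_of_nonneg_of_nonpos hs ?_)
      have := Real.sin_nonneg_of_nonneg_of_le_pi (x := α - β) (by linarith) (by linarith)
      rw [hγ, ← neg_sub, Real.sin_neg]
      linarith
    · have : polarPoint (r * Real.cos (θ - (β - Real.pi))) (β - Real.pi) =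
          polarPoint (r * Real.cos (β - θ)) β := by
        have hc : Real.cos (θ - (β - Real.pi)) = -Real.cos (β - θ) := by
          rw [show θ - (β - Real.pi) = Real.pi - (β - θ) by ring, Real.cos_pi_sub]
        ext i
        fin_cases i <;> simp [hc, Real.cos_sub_pi, Real.sin_sub_pi]
      rw [this]
      exact mem_compl (by positivity) (by linarith) hβ₂ (.inr le_rfl)

/-- The canonical equivalence `ℝ × ℝ ≃ᵐ EuclideanSpace ℝ (Fin 2)` is measure preserving. -/
lemma volume_preserving_euclideanOfProd : MeasurePreserving
    ((MeasurableEquiv.finTwoArrow (α := ℝ)).symm.trans (MeasurableEquiv.toLp 2 (Fin 2 → ℝ))) :=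
  ((volume_preserving_finTwoArrow ℝ).symm _).trans
    ((EuclideanSpace.volume_preserving_symm_measurableEquiv_toLp (Fin 2)).symm _)

lemma injOn_polarCoord_symm_of_Ioo_zero_two_pi :
    Set.InjOn polarCoord.symm (Set.Ioi (0 : ℝ) ×ˢ Set.Ioo (0 : ℝ) (2 * Real.pi)) := by
  rintro ⟨r, θ⟩ ⟨hr, hθ⟩ ⟨r', θ'⟩ ⟨hr', hθ'⟩ h
  simp only [Set.mem_Ioi, Set.mem_Ioo] at hr hθ hr' hθ'
  obtain ⟨hc, hs⟩ := Prod.ext_iff.1 h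
  obtain ⟨rfl, rfl⟩ := polarPoint_injOn hr.le hr' (by linarith) (by linarith) hc hs
  rfl

lemma image_polarCoord_symm_ae_eq_univ :
    polarCoord.symm '' (Set.Ioi (0 : ℝ) ×ˢ Set.Ioo (0 : ℝ) (2 * Real.pi)) =ᵐ[volume]
      (Set.univ : Set (ℝ × ℝ)) := by
  have A : (polarCoord.symm '' (Set.Ioi (0 : ℝ) ×ˢ Set.Ioo (0 : ℝ) (2 * Real.pi)))ᶜ ⊆
      LinearMap.ker (LinearMap.snd ℝ ℝ ℝ) := by
    intro x hx
    by_contra h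
    have h2 : x.2 ≠ 0 := h
    obtain ⟨r, θ, hr, h0, hθ, e⟩ := exists_eq_polarPoint !₂[x.1, x.2]
    have e1 : x.1 = r * Real.cos θ := congrArg (fun y : EuclideanSpace ℝ (Fin 2) ↦ y 0) e
    have e2 : x.2 = r * Real.sin θ := congrArg (fun y : EuclideanSpace ℝ (Fin 2) ↦ y 1) e
    refine hx ⟨(r, θ), ⟨hr.lt_of_ne ?_, h0, hθ.lt_of_ne ?_⟩, Prod.ext e1.symm e2.symm⟩
    · rintro rfl
      simp [e2] at h2
    · rintro rfl
      simp [e2] at h2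
  have B : volume (LinearMap.ker (LinearMap.snd ℝ ℝ ℝ) : Set (ℝ × ℝ)) = 0 := by
    apply Measure.addHaar_submodule
    rw [Ne, LinearMap.ker_eq_top]
    intro h
    have : (LinearMap.snd ℝ ℝ ℝ) (0, 1) = (0 : ℝ × ℝ →ₗ[ℝ] ℝ) (0, 1) := by rw [h]
    simp at this
  exact ae_eq_univ.2 (measure_mono_null A B)

lemma abs_det_fderivPolarCoordSymm {p : ℝ × ℝ} (hp : 0 < p.1) :
    |(fderivPolarCoordSymm p).det| = p.1 := by
  rw [det_fderivPolarCoordSymm, abs_of_pos hp]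

lemma setIntegral_polarPoint (F : EuclideanSpace ℝ (Fin 2) → ℝ) :
    ∫ p in Set.Ioi (0 : ℝ) ×ˢ Set.Ioo (0 : ℝ) (2 * Real.pi), p.1 * F (polarPoint p.1 p.2) =
      ∫ x, F x := by
  rw [← volume_preserving_euclideanOfProd.integral_comp (MeasurableEquiv.measurableEmbedding _),
    ← setIntegral_univ (μ := (volume : Measure (ℝ × ℝ))),
    ← setIntegral_congr_set image_polarCoord_symm_ae_eq_univ,
    integral_image_eq_integral_abs_det_fderiv_smul volume
      (measurableSet_Ioi.prod measurableSet_Ioo)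
      (fun p _ ↦ (hasFDerivAt_polarCoord_symm p).hasFDerivWithinAt)
      injOn_polarCoord_symm_of_Ioo_zero_two_pi]
  refine setIntegral_congr_fun (measurableSet_Ioi.prod measurableSet_Ioo) fun p hp ↦ ?_
  simp only [abs_det_fderivPolarCoordSymm hp.1, smul_eq_mul]
  rfl

lemma integrableOn_polarPoint {F : EuclideanSpace ℝ (Fin 2) → ℝ} (hF : Integrable F) :
    IntegrableOn (fun p : ℝ × ℝ ↦ p.1 * F (polarPoint p.1 p.2))
      (Set.Ioi (0 : ℝ) ×ˢ Set.Ioo (0 : ℝ) (2 * Real.pi)) := by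
  rw [← volume_preserving_euclideanOfProd.integrable_comp_emb
    (MeasurableEquiv.measurableEmbedding _)] at hF
  have := (integrableOn_image_iff_integrableOn_abs_det_fderiv_smul volume
      (measurableSet_Ioi.prod measurableSet_Ioo)
      (fun p _ ↦ (hasFDerivAt_polarCoord_symm p).hasFDerivWithinAt)
      injOn_polarCoord_symm_of_Ioo_zero_two_pi _).1
        (hF.integrableOn (s := polarCoord.symm ''
          (Set.Ioi (0 : ℝ) ×ˢ Set.Ioo (0 : ℝ) (2 * Real.pi))))
  refine this.congr_fun (fun p hp ↦ ?_) (measurableSet_Ioi.prod measurableSet_Ioo)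
  simp only [abs_det_fderivPolarCoordSymm hp.1, smul_eq_mul]
  rfl

lemma polarPoint_notMem_sector {β r θ : ℝ} (hβ₂ : β ≤ 2 * Real.pi) (hr : 0 < r)
    (h : θ ∈ Set.Ioo 0 (2 * Real.pi) \ Set.Ioo 0 β) : polarPoint r θ ∉ sector β := fun hm ↦
  h.2 (pos_of_polarPoint_mem_sector hβ₂ hr.le h.1.1.le h.1.2.le hm).2

lemma setIntegral_sector {β : ℝ} (hβ₂ : β ≤ 2 * Real.pi) (F : EuclideanSpace ℝ (Fin 2) → ℝ)
    (hF : ∀ x ∉ sector β, F x = 0) :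
    ∫ x in sector β, F x =
      ∫ p in Set.Ioi (0 : ℝ) ×ˢ Set.Ioo (0 : ℝ) β, p.1 * F (polarPoint p.1 p.2) := by
  rw [setIntegral_eq_integral_of_forall_compl_eq_zero hF, ← setIntegral_polarPoint]
  refine setIntegral_eq_of_subset_of_forall_sdiff_eq_zero
    (measurableSet_Ioi.prod measurableSet_Ioo)
    (Set.prod_mono_right (Set.Ioo_subset_Ioo_right hβ₂)) fun p hp ↦ ?_
  rw [hF _ (polarPoint_notMem_sector hβ₂ hp.1.1 ⟨hp.1.2, fun h ↦ hp.2 ⟨hp.1.1, h⟩⟩), mul_zero]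

lemma hasDerivAt_plane {f : ℝ → EuclideanSpace ℝ (Fin 2)} {f' : EuclideanSpace ℝ (Fin 2)} {t : ℝ}
    (h0 : HasDerivAt (fun s ↦ f s 0) (f' 0) t) (h1 : HasDerivAt (fun s ↦ f s 1) (f' 1) t) :
    HasDerivAt f f' t := by
  have h : HasDerivAt (fun s ↦ (f s).ofLp) f'.ofLp t := by
    rw [hasDerivAt_pi]
    intro i
    fin_cases i
    exacts [h0, h1]
  exact (PiLp.continuousLinearEquiv 2 ℝ fun _ : Fin 2 ↦ ℝ).symm.hasFDerivAt.comp_hasDerivAt t h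

lemma hasDerivAt_polarPoint_angle (r θ : ℝ) :
    HasDerivAt (fun t ↦ polarPoint r t) (polarPoint r (θ + Real.pi / 2)) θ := by
  refine hasDerivAt_plane ?_ ?_
  · simpa [Real.cos_add_pi_div_two] using (Real.hasDerivAt_cos θ).const_mul r
  · simpa [Real.sin_add_pi_div_two] using (Real.hasDerivAt_sin θ).const_mul r

lemma hasDerivAt_polarPoint_radius (r θ : ℝ) :
    HasDerivAt (fun s ↦ polarPoint s θ) (polarPoint 1 θ) r := by
  refine hasDerivAt_plane ?_ ?_
  · simpa using (hasDerivAt_id r).mul_const (Real.cos θ)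
  · simpa using (hasDerivAt_id r).mul_const (Real.sin θ)

lemma mul_norm_gradient_polarPoint_sq {u : EuclideanSpace ℝ (Fin 2) → ℝ} {r θ : ℝ} (hr : 0 < r)
    (hu : DifferentiableAt ℝ u (polarPoint r θ)) :
    r * ‖gradient u (polarPoint r θ)‖ ^ 2 =
      r * deriv (fun s ↦ u (polarPoint s θ)) r ^ 2 +
        deriv (fun t ↦ u (polarPoint r t)) θ ^ 2 / r := by
  have key (v : EuclideanSpace ℝ (Fin 2)) :
      fderiv ℝ u (polarPoint r θ) v =
        gradient u (polarPoint r θ) 0 * v 0 + gradient u (polarPoint r θ) 1 * v 1 := by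
    rw [← inner_gradient_left, PiLp.inner_apply, Fin.sum_univ_two]
    simp [mul_comm]
  have hs : deriv (fun s ↦ u (polarPoint s θ)) r = _ :=
    (hu.hasFDerivAt.comp_hasDerivAt r (hasDerivAt_polarPoint_radius r θ)).deriv
  have ht : deriv (fun t ↦ u (polarPoint r t)) θ = _ :=
    (hu.hasFDerivAt.comp_hasDerivAt θ (hasDerivAt_polarPoint_angle r θ)).deriv
  rw [hs, ht, key, key,
    EuclideanSpace.norm_sq_eq, Fin.sum_univ_two]
  simp only [polarPoint_apply_zero, polarPoint_apply_one, Real.cos_add_pi_div_two,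
    Real.sin_add_pi_div_two, Real.norm_eq_abs, sq_abs]
  set a := gradient u (polarPoint r θ) 0
  set b := gradient u (polarPoint r θ) 1
  field_simp
  linear_combination -(a ^ 2 + b ^ 2) * Real.sin_sq_add_cos_sq θ

lemma tsupport_indicator_subset {X : Type*} [TopologicalSpace X] {U K : Set X} {f : X → ℝ}
    (hK : IsClosed K) (h : ∀ x ∈ U, x ∉ K → f x = 0) :
    tsupport (U.indicator f) ⊆ K := by
  refine closure_minimal (fun x hx ↦ ?_) hK
  by_contra hxK
  have hxU : x ∈ U := Set.mem_of_indicator_ne_zero hx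
  exact hx (by rw [Set.indicator_of_mem hxU, h x hxU hxK])

lemma contDiff_indicator {E : Type*} [NormedAddCommGroup E] [NormedSpace ℝ E] {U K : Set E}
    {f : E → ℝ} {n : WithTop ℕ∞} (hU : IsOpen U) (hf : ContDiffOn ℝ n f U)
    (hK : IsClosed K) (hKU : K ⊆ U) (h : ∀ x ∈ U, x ∉ K → f x = 0) :
    ContDiff ℝ n (U.indicator f) := by
  refine contDiff_iff_contDiffAt.2 fun x ↦ ?_
  by_cases hx : x ∈ U
  · exact (hf.contDiffAt (hU.mem_nhds hx)).congr_of_eventuallyEq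
      (Set.eqOn_indicator.eventuallyEq_of_mem (hU.mem_nhds hx))
  · have : x ∉ tsupport (U.indicator f) := fun h' ↦ hx (hKU (tsupport_indicator_subset hK h h'))
    exact contDiffAt_const.congr_of_eventuallyEq (notMem_tsupport_iff_eventuallyEq.1 this)

lemma norm_gradient_eq {n : ℕ} (u : EuclideanSpace ℝ (Fin n) → ℝ) (x : EuclideanSpace ℝ (Fin n)) :
    ‖gradient u x‖ = ‖fderiv ℝ u x‖ := by
  rw [gradient, LinearIsometryEquiv.norm_map]

lemma gradient_eq_zero_of_notMem_tsupport {n : ℕ} {u : EuclideanSpace ℝ (Fin n) → ℝ}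
    {x : EuclideanSpace ℝ (Fin n)} (hx : x ∉ tsupport u) : gradient u x = 0 := by
  rw [gradient, fderiv_of_notMem_tsupport ℝ hx, map_zero]

lemma continuous_norm_gradient_sq {n : ℕ} {u : EuclideanSpace ℝ (Fin n) → ℝ}
    (hu : ContDiff ℝ (⊤ : ℕ∞) u) : Continuous fun x ↦ ‖gradient u x‖ ^ 2 := by
  simp only [norm_gradient_eq]
  exact (hu.continuous_fderiv (by simp)).norm.pow 2

lemma integrable_norm_gradient_sq {n : ℕ} {u : EuclideanSpace ℝ (Fin n) → ℝ}
    (hu : ContDiff ℝ (⊤ : ℕ∞) u) (hc : HasCompactSupport u) :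
    Integrable fun x ↦ ‖gradient u x‖ ^ 2 := by
  refine (continuous_norm_gradient_sq hu).integrable_of_hasCompactSupport ?_
  exact HasCompactSupport.intro hc fun x hx ↦ by
    rw [gradient_eq_zero_of_notMem_tsupport hx, norm_zero, zero_pow two_ne_zero]

lemma eq_zero_of_notMem_of_tsupport_subset {X : Type*} [TopologicalSpace X] {f : X → ℝ} {s : Set X}
    (h : tsupport f ⊆ s) {x : X} (hx : x ∉ s) : f x = 0 :=
  image_eq_zero_of_notMem_tsupport fun hx' ↦ hx (h hx')

lemma setIntegral_norm_gradient_sq_sector {β : ℝ} (hβ₂ : β ≤ 2 * Real.pi)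
    {u : EuclideanSpace ℝ (Fin 2) → ℝ} (hs : tsupport u ⊆ sector β) :
    ∫ x in sector β, ‖gradient u x‖ ^ 2 =
      ∫ p in Set.Ioi (0 : ℝ) ×ˢ Set.Ioo (0 : ℝ) β, p.1 * ‖gradient u (polarPoint p.1 p.2)‖ ^ 2 :=
  setIntegral_sector hβ₂ (fun x ↦ ‖gradient u x‖ ^ 2) fun x hx ↦ by
    rw [gradient_eq_zero_of_notMem_tsupport fun hx' ↦ hx (hs hx'), norm_zero, zero_pow two_ne_zero]

lemma setIntegral_sq_div_infDist_sq_sector {β : ℝ} (hβ₁ : Real.pi ≤ β) (hβ₂ : β ≤ 2 * Real.pi)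
    {u : EuclideanSpace ℝ (Fin 2) → ℝ} (hs : tsupport u ⊆ sector β) :
    ∫ x in sector β, u x ^ 2 / Metric.infDist x (sector β)ᶜ ^ 2 =
      ∫ p in Set.Ioi (0 : ℝ) ×ˢ Set.Ioo (0 : ℝ) β,
        p.1⁻¹ * (u (polarPoint p.1 p.2) ^ 2 * sectorWeight β p.2) := by
  rw [setIntegral_sector hβ₂ (fun x ↦ u x ^ 2 / Metric.infDist x (sector β)ᶜ ^ 2) fun x hx ↦ by
    rw [eq_zero_of_notMem_of_tsupport_subset hs hx, zero_pow two_ne_zero, zero_div]]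
  refine setIntegral_congr_fun (measurableSet_Ioi.prod measurableSet_Ioo) fun p hp ↦ ?_
  have hr : 0 < p.1 := hp.1
  rw [div_eq_mul_inv, infDist_sector_compl_sq hβ₁ hβ₂ hp.1 hp.2.1 hp.2.2]
  field_simp

/-- The one-dimensional Hardy inequality with weight `sectorWeight β` and constant `c`. -/
def AngularHardy (β c : ℝ) : Prop :=
  ∀ g : ℝ → ℝ, ContDiff ℝ (⊤ : ℕ∞) g → HasCompactSupport g → tsupport g ⊆ Set.Ioo 0 β →
    c * ∫ θ in Set.Ioo 0 β, g θ ^ 2 * sectorWeight β θ ≤ ∫ θ in Set.Ioo 0 β, deriv g θ ^ 2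

/-- The two-dimensional Hardy inequality on `sector β` with constant `c`. -/
def SectorHardy (β c : ℝ) : Prop :=
  ∀ u : EuclideanSpace ℝ (Fin 2) → ℝ,
    ContDiff ℝ (⊤ : ℕ∞) u → HasCompactSupport u → tsupport u ⊆ sector β →
    c * ∫ x in sector β, u x ^ 2 / Metric.infDist x (sector β)ᶜ ^ 2 ≤
      ∫ x in sector β, ‖gradient u x‖ ^ 2

lemma continuous_polarPoint_right (r : ℝ) : Continuous fun θ ↦ polarPoint r θ :=
  continuous_polarPoint.comp (by fun_prop : Continuous fun θ : ℝ ↦ (r, θ))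

lemma contDiff_polarPoint_right {n : WithTop ℕ∞} (r : ℝ) : ContDiff ℝ n fun θ ↦ polarPoint r θ := by
  rw [contDiff_euclidean]
  intro i
  fin_cases i
  · exact contDiff_const.mul Real.contDiff_cos
  · exact contDiff_const.mul Real.contDiff_sin

/-- The angular inequality applied to the restriction of `u` to a circular arc. -/
lemma AngularHardy.le_on_arc {β c : ℝ} (hc : AngularHardy β c) (hβ₂ : β ≤ 2 * Real.pi)
    {u : EuclideanSpace ℝ (Fin 2) → ℝ} (hu : ContDiff ℝ (⊤ : ℕ∞) u)
    (hs : tsupport u ⊆ sector β) {r : ℝ} (hr : 0 < r) :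
    c * ∫ θ in Set.Ioo 0 β, r⁻¹ * (u (polarPoint r θ) ^ 2 * sectorWeight β θ) ≤
      ∫ θ in Set.Ioo 0 β, r * ‖gradient u (polarPoint r θ)‖ ^ 2 := by
  set v : ℝ → ℝ := fun θ ↦ u (polarPoint r θ)
  set K : Set ℝ := Set.Icc 0 β ∩ (fun θ ↦ polarPoint r θ) ⁻¹' tsupport u
  have hKc : IsCompact K :=
    isCompact_Icc.inter_right ((isClosed_tsupport u).preimage (continuous_polarPoint_right r))
  have hKU : K ⊆ Set.Ioo 0 β := fun θ hθ ↦
    (pos_of_polarPoint_mem_sector hβ₂ hr.le hθ.1.1 (hθ.1.2.trans hβ₂) (hs hθ.2)).2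
  have hvK : ∀ θ ∈ Set.Ioo 0 β, θ ∉ K → v θ = 0 := fun θ hθ hθK ↦
    image_eq_zero_of_notMem_tsupport (f := u) fun h ↦ hθK ⟨Set.Ioo_subset_Icc_self hθ, h⟩
  have hvs : ContDiff ℝ (⊤ : ℕ∞) v := hu.comp (contDiff_polarPoint_right r)
  have hgs := contDiff_indicator isOpen_Ioo hvs.contDiffOn hKc.isClosed hKU hvK
  have hgt := tsupport_indicator_subset hKc.isClosed hvK
  have hderiv : ∀ θ ∈ Set.Ioo 0 β, deriv ((Set.Ioo 0 β).indicator v) θ = deriv v θ := fun θ hθ ↦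
    (Set.eqOn_indicator.eventuallyEq_of_mem (isOpen_Ioo.mem_nhds hθ)).deriv_eq
  have key := hc _ hgs (hKc.of_isClosed_subset (isClosed_tsupport _) hgt) (hgt.trans hKU)
  rw [setIntegral_congr_fun (g := fun θ ↦ v θ ^ 2 * sectorWeight β θ) measurableSet_Ioo
      fun θ hθ ↦ by simp only [Set.indicator_of_mem hθ],
    setIntegral_congr_fun (f := fun θ ↦ deriv _ θ ^ 2) (g := fun θ ↦ deriv v θ ^ 2) measurableSet_Ioo
      fun θ hθ ↦ by simp only [hderiv θ hθ]] at key
  have hint {w : ℝ → ℝ} (hw : Continuous w) : IntegrableOn w (Set.Ioo 0 β) :=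
    (hw.integrableOn_Icc (a := 0) (b := β)).mono_set Set.Ioo_subset_Icc_self
  calc c * ∫ θ in Set.Ioo 0 β, r⁻¹ * (u (polarPoint r θ) ^ 2 * sectorWeight β θ)
      = r⁻¹ * (c * ∫ θ in Set.Ioo 0 β, v θ ^ 2 * sectorWeight β θ) := by
        rw [integral_const_mul]; ring
    _ ≤ r⁻¹ * ∫ θ in Set.Ioo 0 β, deriv v θ ^ 2 := by gcongr
    _ = ∫ θ in Set.Ioo 0 β, r⁻¹ * deriv v θ ^ 2 := (integral_const_mul _ _).symm
    _ ≤ _ := by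
        refine setIntegral_mono_on
          (hint (continuous_const.mul ((hvs.continuous_deriv (by simp)).pow 2)))
          (hint (continuous_const.mul
            ((continuous_norm_gradient_sq hu).comp (continuous_polarPoint_right r))))
          measurableSet_Ioo fun θ _ ↦ ?_
        rw [mul_norm_gradient_polarPoint_sq hr (hu.differentiable (by simp) _)]
        have : 0 ≤ r * deriv (fun s ↦ u (polarPoint s θ)) r ^ 2 := by positivity
        rw [inv_mul_eq_div]
        linarith

lemma AngularHardy.sectorHardy {β c : ℝ} (hc : AngularHardy β c) (hβ₁ : Real.pi ≤ β)
    (hβ₂ : β ≤ 2 * Real.pi) : SectorHardy β c := by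
  intro u hu hcs hs
  rw [setIntegral_sq_div_infDist_sq_sector hβ₁ hβ₂ hs, setIntegral_norm_gradient_sq_sector hβ₂ hs]
  have hI : IntegrableOn (fun p : ℝ × ℝ ↦ p.1 * ‖gradient u (polarPoint p.1 p.2)‖ ^ 2)
      (Set.Ioi (0 : ℝ) ×ˢ Set.Ioo (0 : ℝ) β) :=
    (integrableOn_polarPoint (integrable_norm_gradient_sq hu hcs)).mono_set
      (Set.prod_mono_right (Set.Ioo_subset_Ioo_right hβ₂))
  by_cases hJ : IntegrableOn (fun p : ℝ × ℝ ↦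
      p.1⁻¹ * (u (polarPoint p.1 p.2) ^ 2 * sectorWeight β p.2))
      (Set.Ioi (0 : ℝ) ×ˢ Set.Ioo (0 : ℝ) β)
  · rw [Measure.volume_eq_prod] at hI hJ ⊢
    rw [setIntegral_prod _ hI, setIntegral_prod _ hJ, ← integral_const_mul]
    rw [IntegrableOn, ← Measure.prod_restrict] at hI hJ
    exact setIntegral_mono_on (hJ.integral_prod_left.const_mul c) hI.integral_prod_left
      measurableSet_Ioi fun r hr ↦ hc.le_on_arc hβ₂ hu hs hr
  · rw [integral_undef hJ, mul_zero]
    exact setIntegral_nonneg (measurableSet_Ioi.prod measurableSet_Ioo) fun p hp ↦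
      mul_nonneg (le_of_lt hp.1) (by positivity)

/-- The complex logarithm of `-(x₀ + i x₁)`. -/
noncomputable def planeLog (x : EuclideanSpace ℝ (Fin 2)) : ℂ :=
  Complex.log (-(x 0 + x 1 * Complex.I))

/-- The plane cut along the nonnegative first coordinate axis. -/
def cutPlane : Set (EuclideanSpace ℝ (Fin 2)) :=
  {x | -(x 0 + x 1 * Complex.I : ℂ) ∈ Complex.slitPlane}

lemma contDiff_neg_toComplex {n : WithTop ℕ∞} :
    ContDiff ℝ n fun x : EuclideanSpace ℝ (Fin 2) ↦ -(x 0 + x 1 * Complex.I : ℂ) := by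
  have h (i : Fin 2) : ContDiff ℝ n fun x : EuclideanSpace ℝ (Fin 2) ↦ (x i : ℂ) :=
    Complex.ofRealCLM.contDiff.comp (contDiff_euclidean.1 contDiff_id i)
  exact ((h 0).add ((h 1).mul contDiff_const)).neg

lemma isOpen_cutPlane : IsOpen cutPlane :=
  Complex.isOpen_slitPlane.preimage (contDiff_neg_toComplex (n := 0)).continuous

lemma contDiffOn_planeLog {n : WithTop ℕ∞} : ContDiffOn ℝ n planeLog cutPlane := fun x hx ↦
  (ContDiffAt.comp (g := Complex.log) x ((Complex.contDiffAt_log hx).restrict_scalars ℝ)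
    contDiff_neg_toComplex.contDiffAt).contDiffWithinAt

lemma neg_toComplex_polarPoint {r θ : ℝ} (hr : 0 < r) :
    -(polarPoint r θ 0 + polarPoint r θ 1 * Complex.I : ℂ) =
      Complex.exp (Real.log r + (θ - Real.pi : ℝ) * Complex.I) := by
  rw [Complex.exp_add, ← Complex.ofReal_exp, Real.exp_log hr, Complex.exp_mul_I,
    ← Complex.ofReal_cos, ← Complex.ofReal_sin, Real.cos_sub_pi, Real.sin_sub_pi]
  simp only [polarPoint_apply_zero, polarPoint_apply_one]
  push_cast
  ring

lemma planeLog_polarPoint {r θ : ℝ} (hr : 0 < r) (h0 : 0 < θ) (hθ : θ < 2 * Real.pi) :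
    planeLog (polarPoint r θ) = Real.log r + (θ - Real.pi : ℝ) * Complex.I := by
  rw [planeLog, neg_toComplex_polarPoint hr, Complex.log_exp]
  · simp only [Complex.add_im, Complex.ofReal_im, Complex.im_ofReal_mul, Complex.I_im]
    linarith
  · simp only [Complex.add_im, Complex.ofReal_im, Complex.im_ofReal_mul, Complex.I_im]
    linarith

lemma mem_cutPlane_iff {x : EuclideanSpace ℝ (Fin 2)} :
    x ∈ cutPlane ↔ ∃ r θ : ℝ, 0 < r ∧ 0 < θ ∧ θ < 2 * Real.pi ∧ x = polarPoint r θ := by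
  constructor
  · intro hx
    obtain ⟨r, θ, hr, h0, hθ, rfl⟩ := exists_eq_polarPoint x
    refine ⟨r, θ, hr.lt_of_ne ?_, h0, hθ.lt_of_ne ?_, rfl⟩
    · rintro rfl
      simp [cutPlane] at hx
    · rintro rfl
      simp [cutPlane, Complex.mem_slitPlane_iff] at hx
      linarith
  · rintro ⟨r, θ, hr, h0, hθ, rfl⟩
    have h := congrArg Complex.im (planeLog_polarPoint hr h0 hθ)
    rw [planeLog, Complex.log_im] at h
    simp only [Complex.add_im, Complex.ofReal_im, Complex.im_ofReal_mul, Complex.I_im] at h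
    refine Complex.mem_slitPlane_iff_arg.2 ⟨?_, ?_⟩
    · rw [h]
      intro h'
      linarith
    · rw [neg_toComplex_polarPoint hr]
      exact Complex.exp_ne_zero _

/-- The function equal to `χ (log r) * g θ` at the point with polar coordinates `(r, θ)`,
`0 < θ < 2π`. -/
noncomputable def separated (χ g : ℝ → ℝ) : EuclideanSpace ℝ (Fin 2) → ℝ :=
  cutPlane.indicator fun x ↦ χ (planeLog x).re * g ((planeLog x).im + Real.pi)

lemma separated_polarPoint (χ g : ℝ → ℝ) {r θ : ℝ} (hr : 0 < r) (h0 : 0 < θ)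
    (hθ : θ < 2 * Real.pi) : separated χ g (polarPoint r θ) = χ (Real.log r) * g θ := by
  rw [separated, Set.indicator_of_mem (mem_cutPlane_iff.2 ⟨r, θ, hr, h0, hθ, rfl⟩),
    planeLog_polarPoint hr h0 hθ]
  simp

section Separated

variable {β : ℝ} {χ g : ℝ → ℝ}

lemma separated_smooth (hβ₂ : β ≤ 2 * Real.pi) (hχ : ContDiff ℝ (⊤ : ℕ∞) χ)
    (hχc : HasCompactSupport χ) (hg : ContDiff ℝ (⊤ : ℕ∞) g) (hgc : HasCompactSupport g)
    (hgs : tsupport g ⊆ Set.Ioo 0 β) :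
    ContDiff ℝ (⊤ : ℕ∞) (separated χ g) ∧ HasCompactSupport (separated χ g) ∧
      tsupport (separated χ g) ⊆ sector β := by
  set K : Set (EuclideanSpace ℝ (Fin 2)) :=
    (fun p : ℝ × ℝ ↦ polarPoint (Real.exp p.1) p.2) '' (tsupport χ ×ˢ tsupport g)
  have hK : IsCompact K := (hχc.prod hgc).image <| continuous_polarPoint.comp
    (by fun_prop : Continuous fun p : ℝ × ℝ ↦ (Real.exp p.1, p.2))
  have hKs : K ⊆ sector β := by
    rintro _ ⟨p, hp, rfl⟩
    exact polarPoint_mem_sector (Real.exp_pos _) (hgs hp.2).1 (hgs hp.2).2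
  have hKU : K ⊆ cutPlane := by
    rintro _ ⟨p, hp, rfl⟩
    exact mem_cutPlane_iff.2
      ⟨_, _, Real.exp_pos _, (hgs hp.2).1, (hgs hp.2).2.trans_le hβ₂, rfl⟩
  have hzero : ∀ x ∈ cutPlane, x ∉ K → χ (planeLog x).re * g ((planeLog x).im + Real.pi) = 0 := by
    intro x hx hxK
    obtain ⟨r, θ, hr, h0, hθ, rfl⟩ := mem_cutPlane_iff.1 hx
    by_contra h
    rw [planeLog_polarPoint hr h0 hθ] at h
    simp only [Complex.add_re, Complex.ofReal_re, Complex.re_ofReal_mul, Complex.I_re, mul_zero,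
      add_zero, Complex.add_im, Complex.ofReal_im, Complex.im_ofReal_mul, Complex.I_im, mul_one,
      zero_add, sub_add_cancel] at h
    refine hxK ⟨(Real.log r, θ), ⟨subset_tsupport _ (left_ne_zero_of_mul h),
      subset_tsupport _ (right_ne_zero_of_mul h)⟩, ?_⟩
    simp only [Real.exp_log hr]
  have hf : ContDiffOn ℝ (⊤ : ℕ∞)
      (fun x ↦ χ (planeLog x).re * g ((planeLog x).im + Real.pi)) cutPlane :=
    (hχ.comp_contDiffOn (Complex.reCLM.contDiff.comp_contDiffOn contDiffOn_planeLog)).mul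
      (hg.comp_contDiffOn
        ((Complex.imCLM.contDiff.comp_contDiffOn contDiffOn_planeLog).add contDiffOn_const))
  have ht := tsupport_indicator_subset hK.isClosed hzero
  exact ⟨contDiff_indicator isOpen_cutPlane hf hK.isClosed hKU hzero,
    hK.of_isClosed_subset (isClosed_tsupport _) ht, ht.trans hKs⟩

lemma mul_norm_gradient_separated_sq (hβ₂ : β ≤ 2 * Real.pi) (hχ : ContDiff ℝ (⊤ : ℕ∞) χ)
    (hχc : HasCompactSupport χ) (hg : ContDiff ℝ (⊤ : ℕ∞) g) (hgc : HasCompactSupport g)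
    (hgs : tsupport g ⊆ Set.Ioo 0 β) {r θ : ℝ} (hr : 0 < r) (h0 : 0 < θ) (hθ : θ < 2 * Real.pi) :
    r * ‖gradient (separated χ g) (polarPoint r θ)‖ ^ 2 =
      (r⁻¹ * deriv χ (Real.log r) ^ 2) * g θ ^ 2 + (r⁻¹ * χ (Real.log r) ^ 2) * deriv g θ ^ 2 := by
  have hd := (separated_smooth hβ₂ hχ hχc hg hgc hgs).1.differentiable (by simp)
  rw [mul_norm_gradient_polarPoint_sq hr (hd _)]
  have e1 : (fun s ↦ separated χ g (polarPoint s θ)) =ᶠ[nhds r] fun s ↦ χ (Real.log s) * g θ := by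
    filter_upwards [lt_mem_nhds hr] with s hs using separated_polarPoint χ g hs h0 hθ
  have e2 : (fun t ↦ separated χ g (polarPoint r t)) =ᶠ[nhds θ] fun t ↦ χ (Real.log r) * g t := by
    filter_upwards [lt_mem_nhds h0, gt_mem_nhds hθ] with t ht ht' using
      separated_polarPoint χ g hr ht ht'
  have d1 : HasDerivAt (fun s ↦ χ (Real.log s) * g θ) (deriv χ (Real.log r) * r⁻¹ * g θ) r :=
    (((hχ.differentiable (by simp)) (Real.log r)).hasDerivAt.comp r
      (Real.hasDerivAt_log hr.ne')).mul_const _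
  have d2 : HasDerivAt (fun t ↦ χ (Real.log r) * g t) (χ (Real.log r) * deriv g θ) θ :=
    ((hg.differentiable (by simp)) θ).hasDerivAt.const_mul _
  rw [e1.deriv_eq, e2.deriv_eq, d1.deriv, d2.deriv]
  field_simp

end Separated

lemma integral_Ioi_inv_mul_comp_log (h : ℝ → ℝ) :
    ∫ r in Set.Ioi (0 : ℝ), r⁻¹ * h (Real.log r) = ∫ t, h t := by
  rw [← Real.range_exp, ← Set.image_univ,
    integral_image_eq_integral_abs_deriv_smul MeasurableSet.univ
      (fun x _ ↦ (Real.hasDerivAt_exp x).hasDerivWithinAt) Real.exp_injective.injOn,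
    setIntegral_univ]
  refine integral_congr_ae (.of_forall fun t ↦ ?_)
  simp [abs_of_pos (Real.exp_pos t), (Real.exp_pos t).ne']

lemma integrableOn_Ioi_inv_mul_comp_log {h : ℝ → ℝ} (hh : Integrable h) :
    IntegrableOn (fun r ↦ r⁻¹ * h (Real.log r)) (Set.Ioi (0 : ℝ)) := by
  rw [← Real.range_exp, ← Set.image_univ,
    integrableOn_image_iff_integrableOn_abs_deriv_smul MeasurableSet.univ
      (fun x _ ↦ (Real.hasDerivAt_exp x).hasDerivWithinAt) Real.exp_injective.injOn,
    integrableOn_univ]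
  refine hh.congr (.of_forall fun t ↦ ?_)
  simp [abs_of_pos (Real.exp_pos t), (Real.exp_pos t).ne']

lemma integrable_sq_of_hasCompactSupport {g : ℝ → ℝ} (hg : Continuous g)
    (hgc : HasCompactSupport g) : Integrable fun t ↦ g t ^ 2 :=
  (hg.pow 2).integrable_of_hasCompactSupport <| HasCompactSupport.intro hgc fun t ht ↦ by
    simp [image_eq_zero_of_notMem_tsupport ht]

lemma SectorHardy.separated {β c : ℝ} (hc : SectorHardy β c) (hβ₁ : Real.pi ≤ β)
    (hβ₂ : β ≤ 2 * Real.pi) {χ g : ℝ → ℝ} (hχ : ContDiff ℝ (⊤ : ℕ∞) χ)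
    (hχc : HasCompactSupport χ) (hg : ContDiff ℝ (⊤ : ℕ∞) g) (hgc : HasCompactSupport g)
    (hgs : tsupport g ⊆ Set.Ioo 0 β) :
    c * ((∫ t, χ t ^ 2) * ∫ θ in Set.Ioo 0 β, g θ ^ 2 * sectorWeight β θ) ≤
      (∫ t, deriv χ t ^ 2) * (∫ θ in Set.Ioo 0 β, g θ ^ 2) +
        (∫ t, χ t ^ 2) * ∫ θ in Set.Ioo 0 β, deriv g θ ^ 2 := by
  obtain ⟨hu, huc, hus⟩ := separated_smooth hβ₂ hχ hχc hg hgc hgs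
  have key := hc _ hu huc hus
  rw [setIntegral_sq_div_infDist_sq_sector hβ₁ hβ₂ hus,
    setIntegral_norm_gradient_sq_sector hβ₂ hus] at key
  have hS : MeasurableSet (Set.Ioi (0 : ℝ) ×ˢ Set.Ioo (0 : ℝ) β) :=
    measurableSet_Ioi.prod measurableSet_Ioo
  have hprod {h k : ℝ → ℝ} (hh : Integrable h) (hk : Integrable k) :
      IntegrableOn (fun p : ℝ × ℝ ↦ (p.1⁻¹ * h (Real.log p.1)) * k p.2)
        (Set.Ioi (0 : ℝ) ×ˢ Set.Ioo (0 : ℝ) β) := by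
    rw [IntegrableOn, Measure.volume_eq_prod, ← Measure.prod_restrict]
    exact (integrableOn_Ioi_inv_mul_comp_log hh).integrable.mul_prod hk.integrableOn
  have hval (h k : ℝ → ℝ) : ∫ p in Set.Ioi (0 : ℝ) ×ˢ Set.Ioo (0 : ℝ) β,
      (p.1⁻¹ * h (Real.log p.1)) * k p.2 = (∫ t, h t) * ∫ θ in Set.Ioo 0 β, k θ := by
    rw [← integral_Ioi_inv_mul_comp_log h]
    exact setIntegral_prod_mul (fun r ↦ r⁻¹ * h (Real.log r)) k _ _
  have hχ' := hχ.continuous_deriv (by simp)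
  have hg' := hg.continuous_deriv (by simp)
  rw [setIntegral_congr_fun (g := fun p : ℝ × ℝ ↦
      (p.1⁻¹ * χ (Real.log p.1) ^ 2) * (g p.2 ^ 2 * sectorWeight β p.2)) hS fun p hp ↦ by
        simp only
        rw [separated_polarPoint χ g hp.1 hp.2.1 (hp.2.2.trans_le hβ₂)]
        ring,
    hval (fun t ↦ χ t ^ 2) (fun θ ↦ g θ ^ 2 * sectorWeight β θ),
    setIntegral_congr_fun hS fun p hp ↦ mul_norm_gradient_separated_sq hβ₂ hχ hχc hg hgc hgs
      hp.1 hp.2.1 (hp.2.2.trans_le hβ₂),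
    integral_add
      (hprod (integrable_sq_of_hasCompactSupport hχ' hχc.deriv)
        (integrable_sq_of_hasCompactSupport hg.continuous hgc))
      (hprod (integrable_sq_of_hasCompactSupport hχ.continuous hχc)
        (integrable_sq_of_hasCompactSupport hg' hgc.deriv)),
    hval (fun t ↦ deriv χ t ^ 2) (fun θ ↦ g θ ^ 2),
    hval (fun t ↦ χ t ^ 2) (fun θ ↦ deriv g θ ^ 2)] at key
  exact key

lemma SectorHardy.angularHardy {β c : ℝ} (hc : SectorHardy β c) (hβ₁ : Real.pi ≤ β)
    (hβ₂ : β ≤ 2 * Real.pi) : AngularHardy β c := by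
  intro g hg hgc hgs
  obtain ⟨φ, -, hφc, hφ, -, hφ0⟩ := exists_contDiff_tsupport_subset (n := (⊤ : ℕ∞))
    (Filter.univ_mem (f := nhds (0 : ℝ)))
  set M := ∫ t, φ t ^ 2
  set N := ∫ t, deriv φ t ^ 2
  set G := ∫ θ in Set.Ioo 0 β, g θ ^ 2
  set A := ∫ θ in Set.Ioo 0 β, g θ ^ 2 * sectorWeight β θ
  set B := ∫ θ in Set.Ioo 0 β, deriv g θ ^ 2
  have hM : 0 < M := by
    refine (hφ.continuous.pow 2).integral_pos_of_hasCompactSupport_nonneg_nonzero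
      (HasCompactSupport.intro hφc fun t ht ↦ by simp [image_eq_zero_of_notMem_tsupport ht])
      (fun t ↦ sq_nonneg _) (x := 0) ?_
    simp [hφ0]
  have hscale : ∀ ε : ℝ, 0 < ε → c * (M * A) ≤ ε ^ 2 * (N * G) + M * B := by
    intro ε hε
    have hχ : ContDiff ℝ (⊤ : ℕ∞) fun t ↦ φ (ε * t) :=
      hφ.comp (contDiff_const.mul contDiff_id)
    have hχc : HasCompactSupport fun t ↦ φ (ε * t) :=
      hφc.comp_homeomorph (Homeomorph.mulLeft₀ ε hε.ne')
    have key := hc.separated hβ₁ hβ₂ hχ hχc hg hgc hgs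
    have hderiv : deriv (fun t ↦ φ (ε * t)) = fun t ↦ ε * deriv φ (ε * t) := by
      ext t
      rw [deriv_comp_mul_left, smul_eq_mul]
    simp only [hderiv, mul_pow, integral_const_mul] at key
    rw [Measure.integral_comp_mul_left (fun t ↦ φ t ^ 2),
      Measure.integral_comp_mul_left (fun t ↦ deriv φ t ^ 2), abs_of_pos (inv_pos.2 hε),
      smul_eq_mul, smul_eq_mul] at key
    refine le_of_mul_le_mul_left ?_ (inv_pos.2 hε)
    linear_combination key
  have hlim : Filter.Tendsto (fun ε : ℝ ↦ ε ^ 2 * (N * G) + M * B) (nhdsWithin 0 (Set.Ioi 0))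
      (nhds (M * B)) := by
    have : Continuous fun ε : ℝ ↦ ε ^ 2 * (N * G) + M * B := by fun_prop
    simpa using this.continuousWithinAt.tendsto (x := 0) (s := Set.Ioi 0)
  have := ge_of_tendsto hlim (Filter.eventually_of_mem self_mem_nhdsWithin hscale)
  refine le_of_mul_le_mul_left ?_ hM
  linear_combination this

/-- **The Hardy constant of a sector as a one-dimensional best constant.**
For `β ∈ [π, 2π]`, the `L²` Hardy constant of the infinite sector `Λ_β` equals the best
constant `c_β` for the inequality `∫_0^β g'² ≥ c ∫_0^β g² V_β` over `g ∈ C_c^∞((0, β))`. -/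
theorem hardy_constant_sector_eq_one_dim
    (β : ℝ) (hβ₁ : Real.pi ≤ β) (hβ₂ : β ≤ 2 * Real.pi) :
    hardyConst (sector β) =
      sSup {c : ℝ | 0 ≤ c ∧ ∀ g : ℝ → ℝ,
        ContDiff ℝ (⊤ : ℕ∞) g → HasCompactSupport g → tsupport g ⊆ Set.Ioo 0 β →
        c * ∫ θ in Set.Ioo 0 β, g θ ^ 2 * sectorWeight β θ
          ≤ ∫ θ in Set.Ioo 0 β, deriv g θ ^ 2} := by
  have h (c : ℝ) : SectorHardy β c ↔ AngularHardy β c :=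
    ⟨fun hc ↦ hc.angularHardy hβ₁ hβ₂, fun hc ↦ hc.sectorHardy hβ₁ hβ₂⟩
  exact congrArg sSup (Set.ext fun c ↦ and_congr_right fun _ ↦ h c)
end
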